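/- arXiv:0804.3667 — 2 statements merged into one kernel-verified Lean document; each statement's English description precedes it below -/
import Mathlib

section
/- Let P be a lattice polytope of degree d. Then P decomposes as a Cayley sum of lattice polytopes in ℝ^q for some q ≤ (d² + 19d − 4)/2; that is, there exist q ≤ (d² + 19d − 4)/2, s ≥ 0 with q + s = dim P, and lattice polytopes P_0, …, P_s in ℝ^q such that P is identified with P_0 * ⋯ * P_s under a ℤ-affine linear change of coordinates. In particular, if dim P > (d² + 19d − 4)/2, then P has a nontrivial Cayley decomposition. -/
open scoped BigOperators Pointwise

noncomputable section

/-- A point of `ℝ^m` with integer coordinates (a lattice point). -/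
def IsLatticePoint {m : ℕ} (v : Fin m → ℝ) : Prop := ∀ i, ∃ z : ℤ, v i = (z : ℝ)

/-- `P` is a lattice polytope in `ℝ^m`: the convex hull of a nonempty finite set of
lattice points. -/
def IsLatticePolytope {m : ℕ} (P : Set (Fin m → ℝ)) : Prop :=
  ∃ V : Finset (Fin m → ℝ), V.Nonempty ∧ (∀ v ∈ V, IsLatticePoint v) ∧
    P = convexHull ℝ (V : Set (Fin m → ℝ))

/-- The number of lattice points contained in a subset of `ℝ^m`. -/
def latticePointCount {m : ℕ} (A : Set (Fin m → ℝ)) : ℕ :=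
  Set.ncard {z : Fin m → ℤ | (fun i => (z i : ℝ)) ∈ A}

/-- `h` is the `h^*`-polynomial of the full-dimensional lattice polytope `P ⊆ ℝ^n`:
its coefficients are nonnegative, it has degree at most `n`, and the Ehrhart counting
function of `P` is given by `|mP ∩ ℤ^n| = ∑_i h_i * C(n + m - i, n)`, which is
equivalent to `∑_m |mP ∩ ℤ^n| t^m = h(t)/(1-t)^{n+1}`. -/
def IsHStarPoly {n : ℕ} (P : Set (Fin n → ℝ)) (h : Polynomial ℤ) : Prop :=
  h.natDegree ≤ n ∧ (∀ i, 0 ≤ h.coeff i) ∧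
    ∀ m : ℕ, (latticePointCount ((m : ℝ) • P) : ℤ) =
      ∑ i ∈ Finset.range (n + 1), h.coeff i * ((n + m - i).choose n : ℤ)

/-- The normalized volume of a (full-dimensional) polytope in `ℝ^m`:
`m!` times its Euclidean volume. -/
def normVol {m : ℕ} (P : Set (Fin m → ℝ)) : ℝ :=
  (Nat.factorial m : ℝ) * (MeasureTheory.volume P).toReal

/-- The point of `ℝ^s` over which the `j`-th summand of a Cayley sum sits:
`0` for `j = 0`, and the standard basis vector `e_j` for `j = 1, …, s`. -/
def cayleyVertex (s : ℕ) (j : Fin (s + 1)) : Fin s → ℝ :=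
  fun i => if (i : ℕ) + 1 = (j : ℕ) then 1 else 0

/-- The Cayley sum `P_0 * ⋯ * P_s ⊆ ℝ^q × ℝ^s` of polytopes `P_0, …, P_s ⊆ ℝ^q`:
the convex hull of `(P_0 × {0}) ∪ (P_1 × {e_1}) ∪ ⋯ ∪ (P_s × {e_s})`. -/
def CayleySum {q s : ℕ} (Ps : Fin (s + 1) → Set (Fin q → ℝ)) :
    Set ((Fin q → ℝ) × (Fin s → ℝ)) :=
  convexHull ℝ (⋃ j : Fin (s + 1), (fun p => (p, cayleyVertex s j)) '' Ps j)

/-- A lattice point of `ℝ^q × ℝ^s`. -/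
def IsLatticePointPair {q s : ℕ} (v : (Fin q → ℝ) × (Fin s → ℝ)) : Prop :=
  IsLatticePoint v.1 ∧ IsLatticePoint v.2

/-- An affine isomorphism `ℝ^n ≅ ℝ^q × ℝ^s` is a `ℤ`-affine linear change of coordinates
if it identifies the lattice `ℤ^n` with the lattice `ℤ^q × ℤ^s`. -/
def IsLatticeEquiv {n q s : ℕ} (T : (Fin n → ℝ) ≃ᵃ[ℝ] (Fin q → ℝ) × (Fin s → ℝ)) : Prop :=
  ∀ v : Fin n → ℝ, IsLatticePoint v ↔ IsLatticePointPair (T v)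

section ConeGeometry

variable {E : Type*} [AddCommGroup E] [Module ℝ E]

/-- The convex cone generated by a finite set of vectors. -/
def genCone (S : Finset E) : Set E :=
  {x | ∃ c : E → ℝ, (∀ v ∈ S, 0 ≤ c v) ∧ ∑ v ∈ S, c v • v = x}

theorem zero_mem_genCone (S : Finset E) : (0 : E) ∈ genCone S :=
  ⟨0, fun _ _ => le_rfl, by simp⟩

theorem genCone_add {S : Finset E} {x y : E} (hx : x ∈ genCone S) (hy : y ∈ genCone S) :
    x + y ∈ genCone S := by
  obtain ⟨c, hc, rfl⟩ := hx
  obtain ⟨e, he, rfl⟩ := hy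
  exact ⟨c + e, fun v hv => add_nonneg (hc v hv) (he v hv), by
    simp [add_smul, Finset.sum_add_distrib]⟩

theorem genCone_smul {S : Finset E} {x : E} (hx : x ∈ genCone S) {t : ℝ} (ht : 0 ≤ t) :
    t • x ∈ genCone S := by
  obtain ⟨c, hc, rfl⟩ := hx
  exact ⟨fun v => t * c v, fun v hv => mul_nonneg ht (hc v hv), by
    simp [mul_smul, Finset.smul_sum]⟩

theorem mem_genCone_of_mem {S : Finset E} {v : E} (hv : v ∈ S) : v ∈ genCone S := by
  classical
  refine ⟨fun w => if w = v then 1 else 0, fun w _ => by dsimp only; split_ifs <;> simp, ?_⟩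
  simp [ite_smul, hv]

theorem genCone_sum {S : Finset E} {ι : Type*} (I : Finset ι) (f : ι → E)
    (h : ∀ i ∈ I, f i ∈ genCone S) : ∑ i ∈ I, f i ∈ genCone S := by
  classical
  induction I using Finset.induction_on with
  | empty => simpa using zero_mem_genCone S
  | insert a I ha ih =>
    rw [Finset.sum_insert ha]
    exact genCone_add (h a (Finset.mem_insert_self a I))
      (ih fun i hi => h i (Finset.mem_insert_of_mem hi))

theorem genCone_subset {S T : Finset E} (h : ∀ v ∈ S, v ∈ genCone T) :
    genCone S ⊆ genCone T := by
  rintro x ⟨c, hc, rfl⟩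
  exact genCone_sum S _ fun v hv => genCone_smul (h v hv) (hc v hv)

theorem genCone_mono {S T : Finset E} (h : S ⊆ T) : genCone S ⊆ genCone T :=
  genCone_subset fun _ hv => mem_genCone_of_mem (h hv)

/-- A vector is interior to the cone over `V` if it is an order unit for it. -/
def IsConeInterior (V : Finset E) (x : E) : Prop :=
  ∀ w : E, ∃ t : ℝ, 0 ≤ t ∧ t • x - w ∈ genCone V

theorem IsConeInterior.mono_scale {V : Finset E} {x w : E} {t : ℝ} (hx : x ∈ genCone V)
    (h : t • x - w ∈ genCone V) {s : ℝ} (hs : t ≤ s) : s • x - w ∈ genCone V := by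
  have := genCone_add h (genCone_smul hx (sub_nonneg.2 hs))
  convert this using 1
  module

theorem isConeInterior_sum {V : Finset E} (hV : Submodule.span ℝ (V : Set E) = ⊤) :
    IsConeInterior V (∑ v ∈ V, v) := by
  intro w
  have hw : w ∈ Submodule.span ℝ (V : Set E) := by rw [hV]; trivial
  obtain ⟨c, -, rfl⟩ := Submodule.mem_span_finset.1 hw
  refine ⟨∑ v ∈ V, |c v|, Finset.sum_nonneg fun _ _ => abs_nonneg _, ?_⟩
  rw [Finset.smul_sum, ← Finset.sum_sub_distrib]
  refine genCone_sum V _ fun v hv => ?_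
  rw [← sub_smul]
  refine genCone_smul (mem_genCone_of_mem hv) (sub_nonneg.2 ?_)
  exact (le_abs_self _).trans
    (Finset.single_le_sum (f := fun v => |c v|) (fun _ _ => abs_nonneg _) hv)

/-- The smallest face of the cone over `V` containing `S`, extended by the negative cone. -/
def faceOf (V S : Finset E) : Set E :=
  {x | ∃ t : ℝ, 0 ≤ t ∧ t • (∑ v ∈ S, v) - x ∈ genCone V}

theorem faceOf_add {V S : Finset E} {x y : E} (hx : x ∈ faceOf V S) (hy : y ∈ faceOf V S) :
    x + y ∈ faceOf V S := by
  obtain ⟨t, ht, h⟩ := hx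
  obtain ⟨s, hs, h'⟩ := hy
  refine ⟨t + s, add_nonneg ht hs, ?_⟩
  convert genCone_add h h' using 1
  module

theorem faceOf_smul {V S : Finset E} {x : E} (hx : x ∈ faceOf V S) {r : ℝ} (hr : 0 ≤ r) :
    r • x ∈ faceOf V S := by
  obtain ⟨t, ht, h⟩ := hx
  refine ⟨r * t, mul_nonneg hr ht, ?_⟩
  convert genCone_smul h hr using 1
  module

theorem faceOf_sum {V S : Finset E} {ι : Type*} (I : Finset ι) (f : ι → E)
    (h : ∀ i ∈ I, f i ∈ faceOf V S) : ∑ i ∈ I, f i ∈ faceOf V S := by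
  classical
  induction I using Finset.induction_on with
  | empty => exact ⟨0, le_rfl, by simpa using zero_mem_genCone V⟩
  | insert a I ha ih =>
    rw [Finset.sum_insert ha]
    exact faceOf_add (h a (Finset.mem_insert_self a I))
      (ih fun i hi => h i (Finset.mem_insert_of_mem hi))

theorem mem_faceOf_of_mem {V S : Finset E} (hS : S ⊆ V) {v : E} (hv : v ∈ S) :
    v ∈ faceOf V S := by
  classical
  refine ⟨1, zero_le_one, ?_⟩
  rw [one_smul, ← Finset.add_sum_erase S (fun v => v) hv, add_sub_cancel_left]
  exact genCone_sum _ _ fun w hw => mem_genCone_of_mem (hS (Finset.mem_of_mem_erase hw))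

theorem genCone_subset_faceOf {V S : Finset E} (hS : S ⊆ V) : genCone S ⊆ faceOf V S := by
  rintro x ⟨c, hc, rfl⟩
  exact faceOf_sum S _ fun v hv => faceOf_smul (mem_faceOf_of_mem hS hv) (hc v hv)

theorem mem_faceOf_of_sub_mem {V S : Finset E} {x y : E} (hx : x ∈ faceOf V S)
    (h : x - y ∈ genCone V) : y ∈ faceOf V S := by
  obtain ⟨t, ht, h'⟩ := hx
  refine ⟨t, ht, ?_⟩
  convert genCone_add h' h using 1
  module

theorem mem_faceOf_of_smul_mem {V S : Finset E} {x : E} {r : ℝ} (hr : 0 < r)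
    (hx : r • x ∈ faceOf V S) : x ∈ faceOf V S := by
  simpa [smul_smul, inv_mul_cancel₀ hr.ne'] using faceOf_smul hx (inv_nonneg.2 hr.le)

theorem IsConeInterior.of_faceOf {V S : Finset E} {x : E} (hx : IsConeInterior V x)
    (h : x ∈ faceOf V S) : IsConeInterior V (∑ v ∈ S, v) := by
  obtain ⟨s, hs, h'⟩ := h
  intro w
  obtain ⟨t, ht, htw⟩ := hx w
  refine ⟨t * s, mul_nonneg ht hs, ?_⟩
  convert genCone_add htw (genCone_smul h' ht) using 1
  module

theorem faceOf_mono {V S T : Finset E} (hS : S ⊆ T) (hT : T ⊆ V) :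
    faceOf V S ⊆ faceOf V T := by
  rintro x ⟨t, ht, h⟩
  refine mem_faceOf_of_sub_mem (faceOf_smul (faceOf_sum S _ fun v hv => ?_) ht) h
  exact mem_faceOf_of_mem hT (hS hv)

/-- A finite set which is a basis, recorded through the existence of dual functionals. -/
def IsBasisSet (σ : Finset E) : Prop :=
  ∃ f : E → (E →ₗ[ℝ] ℝ), (∀ b ∈ σ, ∀ c ∈ σ, b ≠ c → f b c = 0) ∧ (∀ b ∈ σ, f b b = 1) ∧
    ∀ x, ∑ b ∈ σ, f b x • b = x

open Classical in
/-- The coordinate functionals of a finite basis. -/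
def basisCoord (σ : Finset E) : E → (E →ₗ[ℝ] ℝ) :=
  if h : IsBasisSet σ then h.choose else 0

theorem IsBasisSet.coord_ne {σ : Finset E} (h : IsBasisSet σ) {b c : E} (hb : b ∈ σ)
    (hc : c ∈ σ) (hbc : b ≠ c) : basisCoord σ b c = 0 := by
  rw [basisCoord, dif_pos h]
  exact h.choose_spec.1 b hb c hc hbc

theorem IsBasisSet.coord_self {σ : Finset E} (h : IsBasisSet σ) {b : E} (hb : b ∈ σ) :
    basisCoord σ b b = 1 := by
  rw [basisCoord, dif_pos h]
  exact h.choose_spec.2.1 b hb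

theorem IsBasisSet.sum_coord {σ : Finset E} (h : IsBasisSet σ) (x : E) :
    ∑ b ∈ σ, basisCoord σ b x • b = x := by
  rw [basisCoord, dif_pos h]
  exact h.choose_spec.2.2 x

theorem IsBasisSet.coord_sum {σ : Finset E} (h : IsBasisSet σ) (c : E → ℝ) {b : E}
    (hb : b ∈ σ) : basisCoord σ b (∑ v ∈ σ, c v • v) = c b := by
  rw [map_sum, Finset.sum_eq_single_of_mem b hb]
  · simp [h.coord_self hb]
  · intro v hv hvb
    simp [h.coord_ne hb hv hvb.symm]

theorem IsBasisSet.ext_coord {σ : Finset E} (h : IsBasisSet σ) {x y : E}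
    (hxy : ∀ b ∈ σ, basisCoord σ b x = basisCoord σ b y) : x = y := by
  rw [← h.sum_coord x, ← h.sum_coord y]
  exact Finset.sum_congr rfl fun b hb => by rw [hxy b hb]

theorem IsBasisSet.apply_eq {σ : Finset E} (h : IsBasisSet σ) (f : E →ₗ[ℝ] ℝ) (x : E) :
    f x = ∑ b ∈ σ, basisCoord σ b x * f b := by
  conv_lhs => rw [← h.sum_coord x, map_sum]
  simp

theorem isBasisSet_of_linearIndepOn {σ : Finset E}
    (hli : LinearIndepOn ℝ id (σ : Set E)) (hsp : Submodule.span ℝ (σ : Set E) = ⊤) :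
    IsBasisSet σ := by
  classical
  have hli' : LinearIndependent ℝ (fun b : σ => (b : E)) := hli
  let B : Module.Basis σ ℝ E := Module.Basis.mk hli' (by
    rw [← hsp]; simp)
  have hB : ∀ b : σ, B b = b := fun b => by simp [B]
  refine ⟨fun b => if h : b ∈ σ then B.coord ⟨b, h⟩ else 0, ?_, ?_, ?_⟩
  · intro b hb c hc hbc
    have h1 := B.repr_self ⟨c, hc⟩
    rw [hB] at h1
    simp [hb, h1, hbc.symm]
  · intro b hb
    have h1 := B.repr_self ⟨b, hb⟩
    rw [hB] at h1
    simp [hb, h1]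
  · intro x
    rw [← Finset.sum_coe_sort]
    conv_rhs => rw [← B.sum_repr x]
    refine Finset.sum_congr rfl fun b _ => ?_
    simp [hB]

theorem IsBasisSet.linearIndepOn {σ : Finset E} (h : IsBasisSet σ) :
    LinearIndepOn ℝ id (σ : Set E) := by
  rw [linearIndepOn_finset_iff]
  intro c hc b hb
  have := h.coord_sum c hb
  simp only [id] at hc
  rw [hc, map_zero] at this
  exact this.symm

theorem IsBasisSet.span_eq {σ : Finset E} (h : IsBasisSet σ) :
    Submodule.span ℝ (σ : Set E) = ⊤ := by
  rw [eq_top_iff]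
  intro x _
  rw [← h.sum_coord x]
  exact Submodule.sum_mem _ fun b hb => Submodule.smul_mem _ _ (Submodule.subset_span hb)

theorem IsBasisSet.card_eq {σ : Finset E} (h : IsBasisSet σ) :
    σ.card = Module.finrank ℝ E := by
  have hli : LinearIndependent ℝ (fun b : σ => (b : E)) := h.linearIndepOn
  let B : Module.Basis σ ℝ E := Module.Basis.mk hli (by rw [← h.span_eq]; simp)
  rw [Module.finrank_eq_card_basis B]; simp

/-- A linearly independent part of a finite spanning set extends to a basis inside it. -/
theorem exists_isBasisSet_between {S T : Finset E} (hST : S ⊆ T)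
    (hS : LinearIndepOn ℝ id (S : Set E)) (hT : Submodule.span ℝ (T : Set E) = ⊤) :
    ∃ σ : Finset E, S ⊆ σ ∧ σ ⊆ T ∧ IsBasisSet σ := by
  have hST' : (S : Set E) ⊆ T := by exact_mod_cast hST
  have hfin : (hS.extend hST').Finite := T.finite_toSet.subset (hS.extend_subset hST')
  refine ⟨hfin.toFinset, ?_, ?_, isBasisSet_of_linearIndepOn ?_ ?_⟩
  · intro x hx
    exact hfin.mem_toFinset.2 (hS.subset_extend hST' hx)
  · intro x hx
    exact hS.extend_subset hST' (hfin.mem_toFinset.1 hx)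
  · rw [hfin.coe_toFinset]
    exact hS.linearIndepOn_extend hST'
  · rw [hfin.coe_toFinset, hS.span_extend_eq_span, hT]

end ConeGeometry

section RegularTriangulation

open Filter Topology

variable {E : Type*} [NormedAddCommGroup E] [NormedSpace ℝ E]

/-- The bases contained in a finite set of vectors. -/
def basesOf (V : Finset E) : Set (Finset E) := {σ | σ ⊆ V ∧ IsBasisSet σ}

theorem basesOf_finite (V : Finset E) : (basesOf V).Finite := by
  classical
  refine (V.powerset.finite_toSet).subset fun σ hσ => ?_
  simpa using hσ.1

/-- A weight is generic for `V` if no vector of `V` is on the affine function interpolating the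
weights on a basis not containing it. -/
def IsGenericWeight (V : Finset E) (ω : E → ℝ) : Prop :=
  ∀ σ ∈ basesOf V, ∀ v ∈ V, v ∉ σ → ∑ b ∈ σ, basisCoord σ b v * ω b ≠ ω v

/-- The bases that are cells of the triangulation induced by the weight `ω`. -/
def cellsOf (V : Finset E) (ω : E → ℝ) : Set (Finset E) :=
  {σ | σ ∈ basesOf V ∧ ∀ v ∈ V, v ∉ σ → ∑ b ∈ σ, basisCoord σ b v * ω b < ω v}

/-- A vector is generic for `V` if its coordinates in all bases from `V` are nonzero. -/
def IsGenericVector (V : Finset E) (z : E) : Prop :=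
  ∀ σ ∈ basesOf V, ∀ b ∈ σ, basisCoord σ b z ≠ 0

theorem exists_isGenericWeight (V : Finset E) : ∃ ω : E → ℝ, IsGenericWeight V ω := by
  classical
  have : Finite (basesOf V) := (basesOf_finite V).to_subtype
  let ι := {p : basesOf V × V // (p.2 : E) ∉ (p.1 : Finset E)}
  let f : ι → Module.Dual ℝ (E → ℝ) := fun p =>
    (∑ b ∈ (p.1.1 : Finset E), basisCoord p.1.1 b p.1.2 • LinearMap.proj (R := ℝ) b) -
      LinearMap.proj (R := ℝ) (p.1.2 : E)
  obtain ⟨ω, hω⟩ := Module.Dual.exists_forall_ne_zero_of_forall_exists f (by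
    rintro ⟨⟨σ, v⟩, hv⟩
    refine ⟨fun w => if w = v then 1 else 0, ?_⟩
    have hv' : ∀ b ∈ (σ : Finset E), b ≠ v := fun b hb h => hv (h ▸ hb)
    simp only [f, LinearMap.sub_apply, LinearMap.sum_apply, LinearMap.smul_apply,
      LinearMap.proj_apply]
    rw [Finset.sum_eq_zero]
    · simp
    · intro b hb
      simp [hv' b hb])
  refine ⟨ω, fun σ hσ v hv hvσ h => hω ⟨⟨⟨σ, hσ⟩, ⟨v, hv⟩⟩, hvσ⟩ ?_⟩
  simp [f, LinearMap.sum_apply, h]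

theorem exists_isGenericVector (V : Finset E) : ∃ z : E, IsGenericVector V z := by
  classical
  have : Finite (basesOf V) := (basesOf_finite V).to_subtype
  let ι := Σ σ : basesOf V, (σ : Finset E)
  let f : ι → Module.Dual ℝ E := fun p => basisCoord p.1 p.2
  obtain ⟨z, hz⟩ := Module.Dual.exists_forall_ne_zero_of_forall_exists f (by
    rintro ⟨σ, b⟩
    refine ⟨b, ?_⟩
    simp [f, σ.2.2.coord_self b.2])
  exact ⟨z, fun σ hσ b hb => hz ⟨⟨σ, hσ⟩, ⟨b, hb⟩⟩⟩

theorem eventually_nonneg_perturb {a r : ℝ} (ha : 0 ≤ a) (h : r < 0 → 0 < a) :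
    ∀ᶠ ε in 𝓝[>] (0 : ℝ), 0 ≤ a + ε * r := by
  rcases lt_or_ge r 0 with hr | hr
  · have hc : Tendsto (fun ε : ℝ => a + ε * r) (𝓝[>] 0) (𝓝 (a + 0 * r)) :=
      (by fun_prop : Continuous fun ε : ℝ => a + ε * r).continuousAt.mono_left
        nhdsWithin_le_nhds
    have : 0 < a + 0 * r := by simpa using h hr
    exact (hc.eventually (lt_mem_nhds this)).mono fun ε hε => hε.le
  · filter_upwards [self_mem_nhdsWithin] with ε hε
    have : 0 < ε := hε
    positivity

theorem exists_optimal_weights {V : Finset E} {ht : E →ₗ[ℝ] ℝ} (hht : ∀ v ∈ V, ht v = 1)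
    (ω : E → ℝ) {z : E} (hz : z ∈ genCone V) :
    ∃ c : E → ℝ, (∀ v ∈ V, 0 ≤ c v) ∧ ∑ v ∈ V, c v • v = z ∧
      ∀ r : E → ℝ, ∑ v ∈ V, r v • v = 0 → (∀ v ∈ V, r v < 0 → 0 < c v) →
        0 ≤ ∑ v ∈ V, r v * ω v := by
  classical
  let K : Set (E → ℝ) :=
    Set.pi Set.univ (fun v => if v ∈ V then Set.Icc 0 (ht z) else {0}) ∩
      {c | ∑ v ∈ V, c v • v = z}
  have hcomp : IsCompact K := by
    refine (isCompact_univ_pi fun v => ?_).inter_right ?_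
    · split_ifs
      · exact isCompact_Icc
      · exact isCompact_singleton
    · exact isClosed_eq (by fun_prop) continuous_const
  have hmem : ∀ c : E → ℝ, (∀ v ∈ V, 0 ≤ c v) → ∑ v ∈ V, c v • v = z →
      (fun v => if v ∈ V then c v else 0) ∈ K := by
    intro c hc hcz
    refine ⟨?_, ?_⟩
    · intro v _
      by_cases hv : v ∈ V
      · have hsum : ht z = ∑ v ∈ V, c v := by
          rw [← hcz, map_sum]
          exact Finset.sum_congr rfl fun v hv => by simp [hht v hv]
        simp only [hv, if_true]
        refine ⟨hc v hv, ?_⟩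
        rw [hsum]
        exact Finset.single_le_sum (f := c) hc hv
      · simp [hv]
    · show ∑ v ∈ V, (if v ∈ V then c v else 0) • v = z
      rw [← hcz]
      exact Finset.sum_congr rfl fun v hv => by simp [hv]
  obtain ⟨c₀, hc₀, hc₀z⟩ := hz
  obtain ⟨c, hcK, hmin⟩ := hcomp.exists_isMinOn ⟨_, hmem c₀ hc₀ hc₀z⟩
    (f := fun c : E → ℝ => ∑ v ∈ V, c v * ω v) (by fun_prop)
  have hc : ∀ v ∈ V, 0 ≤ c v := fun v hv => by
    have := hcK.1 v trivial
    simp only [hv, if_true] at this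
    exact this.1
  refine ⟨c, hc, hcK.2, fun r hr hrc => ?_⟩
  have hev : ∀ᶠ ε in 𝓝[>] (0 : ℝ), ∀ v ∈ V, 0 ≤ c v + ε * r v :=
    (Finset.eventually_all V).2 fun v hv => eventually_nonneg_perturb (hc v hv) (hrc v hv)
  obtain ⟨ε, hε, hε0⟩ := (hev.and self_mem_nhdsWithin).exists
  have hε0 : 0 < ε := hε0
  have hz' : ∑ v ∈ V, (c v + ε * r v) • v = z := by
    have h2 : ∑ v ∈ V, c v • v = z := hcK.2
    simp only [add_smul, mul_smul, Finset.sum_add_distrib, ← Finset.smul_sum, hr, h2]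
    simp
  have h := hmin (hmem _ hε hz')
  have h1 : ∑ v ∈ V, c v * ω v ≤ ∑ v ∈ V, (if v ∈ V then c v + ε * r v else 0) * ω v := h
  have h2 : ∑ v ∈ V, (if v ∈ V then c v + ε * r v else 0) * ω v =
      ∑ v ∈ V, c v * ω v + ε * ∑ v ∈ V, r v * ω v := by
    rw [Finset.mul_sum, ← Finset.sum_add_distrib]
    exact Finset.sum_congr rfl fun v hv => by simp only [hv, if_true]; ring
  rw [h2] at h1
  exact nonneg_of_mul_nonneg_right (by linarith) hε0

theorem sum_ite_mem_smul {V σ : Finset E} [DecidableEq E] (h : σ ⊆ V) (g : E → ℝ) :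
    ∑ w ∈ V, (if w ∈ σ then g w else 0) • w = ∑ w ∈ σ, g w • w := by
  rw [← Finset.sum_subset h]
  · exact Finset.sum_congr rfl fun w hw => by simp [hw]
  · intro w _ hw
    simp [hw]

theorem exists_cell {V : Finset E} {ht : E →ₗ[ℝ] ℝ} (hht : ∀ v ∈ V, ht v = 1)
    (hV : Submodule.span ℝ (V : Set E) = ⊤) {ω : E → ℝ} (hω : IsGenericWeight V ω)
    {z : E} (hz : z ∈ genCone V) (hgen : IsGenericVector V z) :
    ∃ σ ∈ cellsOf V ω, ∀ b ∈ σ, 0 < basisCoord σ b z := by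
  classical
  obtain ⟨c, hc, hcz, hopt⟩ := exists_optimal_weights hht ω hz
  let I : Finset E := V.filter fun v => 0 < c v
  have hIV : I ⊆ V := Finset.filter_subset _ _
  have hzI : ∑ v ∈ I, c v • v = z := by
    rw [← hcz]
    refine Finset.sum_subset hIV fun v hv hvI => ?_
    have : c v = 0 := le_antisymm (not_lt.1 fun h => hvI (Finset.mem_filter.2 ⟨hv, h⟩)) (hc v hv)
    simp [this]
  have hemp : LinearIndepOn ℝ id (∅ : Set E) := linearIndepOn_empty ℝ id
  let S' := hemp.extend (Set.empty_subset (I : Set E))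
  have hS'I : S' ⊆ I := hemp.extend_subset _
  have hS'fin : S'.Finite := I.finite_toSet.subset hS'I
  have hSli : LinearIndepOn ℝ id (hS'fin.toFinset : Set E) := by
    rw [hS'fin.coe_toFinset]; exact hemp.linearIndepOn_extend _
  have hSI : hS'fin.toFinset ⊆ I := fun x hx => hS'I (hS'fin.mem_toFinset.1 hx)
  obtain ⟨σ, hSσ, hσV, hσ⟩ := exists_isBasisSet_between (hSI.trans hIV) hSli hV
  have hzS : z ∈ Submodule.span ℝ (S' : Set E) := by
    rw [hemp.span_extend_eq_span, ← hzI]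
    exact Submodule.sum_mem _ fun v hv => Submodule.smul_mem _ _ (Submodule.subset_span hv)
  have hσI : σ ⊆ I := by
    refine fun b hb => hSI ?_
    by_contra hbS
    refine hgen σ ⟨hσV, hσ⟩ b hb ?_
    have : Submodule.span ℝ (S' : Set E) ≤ LinearMap.ker (basisCoord σ b) := by
      rw [Submodule.span_le]
      intro w hw
      have hw' : w ∈ hS'fin.toFinset := hS'fin.mem_toFinset.2 hw
      exact hσ.coord_ne hb (hSσ hw') fun h => hbS (h ▸ hw')
    exact this hzS
  let r : E → E → ℝ := fun v w =>
    (if w ∈ ({v} : Finset E) then 1 else 0) - (if w ∈ σ then basisCoord σ w v else 0)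
  have hr0 : ∀ v ∈ V, ∑ w ∈ V, r v w • w = 0 := by
    intro v hv
    simp only [r, sub_smul, Finset.sum_sub_distrib]
    rw [sum_ite_mem_smul (Finset.singleton_subset_iff.2 hv) (fun _ => (1 : ℝ)),
      sum_ite_mem_smul hσV (fun w => basisCoord σ w v), hσ.sum_coord]
    simp
  have hrω : ∀ v ∈ V, ∑ w ∈ V, r v w * ω w = ω v - ∑ b ∈ σ, basisCoord σ b v * ω b := by
    intro v hv
    simp only [r, sub_mul, Finset.sum_sub_distrib, ite_mul, zero_mul, one_mul,
      Finset.sum_ite_mem]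
    rw [Finset.inter_eq_right.2 hσV, Finset.inter_eq_right.2 (Finset.singleton_subset_iff.2 hv)]
    simp
  have hle : ∀ v ∈ V, ∑ b ∈ σ, basisCoord σ b v * ω b ≤ ω v := by
    intro v hv
    rw [← sub_nonneg, ← hrω v hv]
    refine hopt _ (hr0 v hv) fun w hw hneg => ?_
    by_cases hwσ : w ∈ σ
    · exact (Finset.mem_filter.1 (hσI hwσ)).2
    · simp only [r, hwσ, if_false, sub_zero] at hneg
      split_ifs at hneg <;> linarith
  have hIσ : I ⊆ σ := by
    intro v hvI
    by_contra hvσ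
    have hv := hIV hvI
    refine hω σ ⟨hσV, hσ⟩ v hv hvσ (le_antisymm (hle v hv) ?_)
    rw [← sub_nonpos, ← hrω v hv, ← neg_nonneg, ← Finset.sum_neg_distrib]
    have := hopt (fun w => - r v w) (by simp [hr0 v hv]) (fun w hw hneg => by
      by_cases hwσ : w ∈ σ
      · exact (Finset.mem_filter.1 (hσI hwσ)).2
      · by_cases hwv : w = v
        · rw [hwv]; exact (Finset.mem_filter.1 hvI).2
        · simp [r, hwσ, hwv] at hneg)
    simpa using this
  have hEq : I = σ := hIσ.antisymm hσI
  refine ⟨σ, ⟨⟨hσV, hσ⟩, fun v hv hvσ =>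
    lt_of_le_of_ne (hle v hv) (hω σ ⟨hσV, hσ⟩ v hv hvσ)⟩, fun b hb => ?_⟩
  rw [← hzI, hEq, hσ.coord_sum c hb]
  exact (Finset.mem_filter.1 (hσI hb)).2

theorem cell_unique {V : Finset E} {ω : E → ℝ} {σ τ : Finset E} (hσ : σ ∈ cellsOf V ω)
    (hτ : τ ∈ cellsOf V ω) {z : E} (hzσ : ∀ b ∈ σ, 0 < basisCoord σ b z)
    (hzτ : ∀ b ∈ τ, 0 < basisCoord τ b z) : σ = τ := by
  classical
  have key : ∀ {σ τ : Finset E}, σ ∈ cellsOf V ω → τ ∈ cellsOf V ω →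
      (∀ b ∈ σ, 0 < basisCoord σ b z) →
      ∑ b ∈ τ, basisCoord τ b z * ω b ≤ ∑ b ∈ σ, basisCoord σ b z * ω b ∧
      (¬ σ ⊆ τ → ∑ b ∈ τ, basisCoord τ b z * ω b < ∑ b ∈ σ, basisCoord σ b z * ω b) := by
    intro σ τ hσ hτ hz
    let f : E →ₗ[ℝ] ℝ := ∑ b ∈ τ, ω b • basisCoord τ b
    have hf : ∀ x, f x = ∑ b ∈ τ, basisCoord τ b x * ω b := fun x => by
      simp [f, LinearMap.sum_apply, mul_comm]
    have hfle : ∀ b ∈ σ, f b ≤ ω b := by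
      intro b hb
      by_cases hbτ : b ∈ τ
      · rw [hf, Finset.sum_eq_single_of_mem b hbτ]
        · simp [hτ.1.2.coord_self hbτ]
        · intro c hc hcb
          simp [hτ.1.2.coord_ne hc hbτ hcb]
      · rw [hf]; exact (hτ.2 b (hσ.1.1 hb) hbτ).le
    rw [← hf, hσ.1.2.apply_eq f z]
    refine ⟨Finset.sum_le_sum fun b hb => mul_le_mul_of_nonneg_left (hfle b hb) (hz b hb).le,
      fun hnot => ?_⟩
    obtain ⟨b, hb, hbτ⟩ := Finset.not_subset.1 hnot
    refine Finset.sum_lt_sum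
      (fun b hb => mul_le_mul_of_nonneg_left (hfle b hb) (hz b hb).le) ⟨b, hb, ?_⟩
    refine mul_lt_mul_of_pos_left ?_ (hz b hb)
    rw [hf]
    exact hτ.2 b (hσ.1.1 hb) hbτ
  have h1 := key hσ hτ hzσ
  have h2 := key hτ hσ hzτ
  refine Finset.Subset.antisymm ?_ ?_
  · by_contra h
    exact absurd (h1.2 h) (not_lt.2 h2.1)
  · by_contra h
    exact absurd (h2.2 h) (not_lt.2 h1.1)

end RegularTriangulation

section HalfOpenDecomposition

open Filter Topology

variable {E : Type*} [NormedAddCommGroup E] [NormedSpace ℝ E]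

/-- The half-open cone over the basis `σ`, with the facets visible from `-y` removed. -/
def HalfOpen (σ : Finset E) (y x : E) : Prop :=
  ∀ b ∈ σ, 0 < basisCoord σ b x ∨ (basisCoord σ b x = 0 ∧ 0 < basisCoord σ b y)

/-- The half-open fundamental parallelepiped of the half-open cone over `σ`. -/
def HalfOpenBox (σ : Finset E) (y z : E) : Prop :=
  ∀ b ∈ σ, (0 < basisCoord σ b y ∧ 0 ≤ basisCoord σ b z ∧ basisCoord σ b z < 1) ∨
    (basisCoord σ b y < 0 ∧ 0 < basisCoord σ b z ∧ basisCoord σ b z ≤ 1)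

theorem eventually_sign_perturb (a : ℝ) {c : ℝ} (hc : c ≠ 0) :
    ∀ᶠ ε in 𝓝[>] (0 : ℝ), a + ε * c ≠ 0 ∧ (0 < a + ε * c ↔ 0 < a ∨ (a = 0 ∧ 0 < c)) := by
  have ht : Tendsto (fun ε : ℝ => a + ε * c) (𝓝[>] 0) (𝓝 (a + 0 * c)) :=
    (by fun_prop : Continuous fun ε : ℝ => a + ε * c).continuousAt.mono_left nhdsWithin_le_nhds
  rw [zero_mul, add_zero] at ht
  rcases lt_trichotomy a 0 with ha | ha | ha
  · filter_upwards [ht.eventually (gt_mem_nhds ha)] with ε hε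
    refine ⟨hε.ne, fun h => absurd h hε.not_gt, ?_⟩
    rintro (h | ⟨h, -⟩) <;> linarith
  · filter_upwards [self_mem_nhdsWithin] with ε hε
    have hε : 0 < ε := hε
    subst ha
    simp [hε, hε.ne', hc]
  · filter_upwards [ht.eventually (lt_mem_nhds ha)] with ε hε
    exact ⟨hε.ne', by simp [hε, ha]⟩

theorem eventually_coord_sign (V : Finset E) {w : E} (hw : IsGenericVector V w) (x : E) :
    ∀ᶠ ε in 𝓝[>] (0 : ℝ), ∀ σ ∈ basesOf V, ∀ b ∈ σ,
      basisCoord σ b (x + ε • w) ≠ 0 ∧ (0 < basisCoord σ b (x + ε • w) ↔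
        0 < basisCoord σ b x ∨ (basisCoord σ b x = 0 ∧ 0 < basisCoord σ b w)) := by
  refine (eventually_all_finite (basesOf_finite V)).2 fun σ hσ =>
    (Finset.eventually_all σ).2 fun b hb => ?_
  simpa using eventually_sign_perturb (basisCoord σ b x) (hw σ hσ b hb)

theorem existsUnique_halfOpen {V : Finset E} {ht : E →ₗ[ℝ] ℝ} (hht : ∀ v ∈ V, ht v = 1)
    (hV : Submodule.span ℝ (V : Set E) = ⊤) {ω : E → ℝ} (hω : IsGenericWeight V ω)
    {y : E} (hy : IsGenericVector V y) (hyC : y ∈ genCone V) {x : E} (hx : x ∈ genCone V) :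
    ∃! σ, σ ∈ cellsOf V ω ∧ HalfOpen σ y x := by
  obtain ⟨ε, hε, hε0⟩ := ((eventually_coord_sign V hy x).and self_mem_nhdsWithin).exists
  have hε0 : 0 < ε := hε0
  have hz : x + ε • y ∈ genCone V := genCone_add hx (genCone_smul hyC hε0.le)
  obtain ⟨σ, hσ, hpos⟩ := exists_cell hht hV hω hz fun σ hσ b hb => (hε σ hσ b hb).1
  refine ⟨σ, ⟨hσ, fun b hb => (hε σ hσ.1 b hb).2.1 (hpos b hb)⟩, ?_⟩
  rintro τ ⟨hτ, hτx⟩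
  exact cell_unique hτ hσ (fun b hb => (hε τ hτ.1 b hb).2.2 (hτx b hb)) hpos

theorem HalfOpen.mem_genCone {V σ : Finset E} (hσ : σ ∈ basesOf V) {y x : E}
    (h : HalfOpen σ y x) : x ∈ genCone V := by
  refine genCone_mono hσ.1 ⟨fun b => basisCoord σ b x, fun b hb => ?_, hσ.2.sum_coord x⟩
  rcases h b hb with h | ⟨h, -⟩
  · exact h.le
  · exact h.ge

theorem halfOpenBox_finite {Λ : AddSubgroup E}
    (hfin : ∀ R : ℝ, {x : E | x ∈ Λ ∧ ‖x‖ ≤ R}.Finite) {σ : Finset E} (hσ : IsBasisSet σ)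
    (y : E) : {z : E | z ∈ Λ ∧ HalfOpenBox σ y z}.Finite := by
  refine (hfin (∑ b ∈ σ, ‖b‖)).subset ?_
  rintro z ⟨hzΛ, hz⟩
  refine ⟨hzΛ, ?_⟩
  conv_lhs => rw [← hσ.sum_coord z]
  refine (norm_sum_le _ _).trans (Finset.sum_le_sum fun b hb => ?_)
  rw [norm_smul]
  refine mul_le_of_le_one_left (norm_nonneg b) ?_
  rw [Real.norm_eq_abs, abs_le]
  rcases hz b hb with h | h <;> constructor <;> linarith [h.2.1, h.2.2]

theorem height_eq_sum_coord {σ : Finset E} (hσ : IsBasisSet σ) {ht : E →ₗ[ℝ] ℝ}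
    (hht : ∀ v ∈ σ, ht v = 1) (x : E) : ht x = ∑ b ∈ σ, basisCoord σ b x := by
  rw [hσ.apply_eq ht x]
  exact Finset.sum_congr rfl fun b hb => by rw [hht b hb, mul_one]

theorem exists_nat_split {a c : ℝ} (hc : c ≠ 0) (h : 0 < a ∨ (a = 0 ∧ 0 < c)) :
    ∃ k : ℕ, (0 < c ∧ 0 ≤ a - k ∧ a - k < 1) ∨ (c < 0 ∧ 0 < a - k ∧ a - k ≤ 1) := by
  rcases lt_or_gt_of_ne hc with hc | hc
  · have ha : 0 < a := by
      rcases h with h | ⟨-, h⟩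
      · exact h
      · exact absurd h hc.not_gt
    have h1 : 1 ≤ ⌈a⌉₊ := Nat.one_le_ceil_iff.2 ha
    have h2 := Nat.ceil_lt_add_one ha.le
    have h3 := Nat.le_ceil a
    refine ⟨⌈a⌉₊ - 1, Or.inr ⟨hc, ?_⟩⟩
    push_cast [h1]
    constructor <;> linarith
  · have ha : 0 ≤ a := by
      rcases h with h | ⟨h, -⟩
      · exact h.le
      · exact h.ge
    have h2 := Nat.floor_le ha
    have h3 := Nat.lt_floor_add_one a
    exact ⟨⌊a⌋₊, Or.inl ⟨hc, by linarith, by linarith⟩⟩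

theorem halfOpen_count {Λ : AddSubgroup E}
    (hfin : ∀ R : ℝ, {x : E | x ∈ Λ ∧ ‖x‖ ≤ R}.Finite) {ht : E →ₗ[ℝ] ℝ} {σ : Finset E}
    (hσ : IsBasisSet σ) (hσΛ : ∀ b ∈ σ, b ∈ Λ) (hht : ∀ b ∈ σ, ht b = 1) {n : ℕ}
    (hcard : σ.card = n + 1) {y : E} (hy : ∀ b ∈ σ, basisCoord σ b y ≠ 0) (m : ℕ) :
    ∃ F : Finset E, (∀ x, x ∈ F ↔ x ∈ Λ ∧ ht x = m ∧ HalfOpen σ y x) ∧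
      F.card = ∑ i ∈ Finset.range (m + 1),
        Set.ncard {z : E | z ∈ Λ ∧ ht z = i ∧ HalfOpenBox σ y z} * (n + m - i).choose n := by
  classical
  have hbfin : ∀ i : ℕ, {z : E | z ∈ Λ ∧ ht z = i ∧ HalfOpenBox σ y z}.Finite := fun i =>
    (halfOpenBox_finite hfin hσ y).subset fun z hz => ⟨hz.1, hz.2.2⟩
  let S : Finset (Σ _ : ℕ, E × (E →₀ ℕ)) := (Finset.range (m + 1)).sigma fun i =>
    (hbfin i).toFinset ×ˢ σ.finsuppAntidiag (m - i)
  let φ : (Σ _ : ℕ, E × (E →₀ ℕ)) → E := fun p => p.2.1 + ∑ b ∈ σ, (p.2.2 b : ℝ) • b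
  have hφ : ∀ p, ∀ b ∈ σ, basisCoord σ b (φ p) = basisCoord σ b p.2.1 + p.2.2 b := by
    intro p b hb
    simp only [φ, map_add]
    rw [hσ.coord_sum (fun b => (p.2.2 b : ℝ)) hb]
  have hS : ∀ p, p ∈ S ↔ p.1 ≤ m ∧ (p.2.1 ∈ Λ ∧ ht p.2.1 = p.1 ∧ HalfOpenBox σ y p.2.1) ∧
      (∑ b ∈ σ, p.2.2 b = m - p.1 ∧ p.2.2.support ⊆ σ) := by
    intro p
    simp [S, Finset.mem_finsuppAntidiag]
  have hinj : Set.InjOn φ S := by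
    rintro ⟨i, z, f⟩ hp ⟨j, z', g⟩ hq heq
    obtain ⟨-, ⟨-, hzi, hz⟩, -, hf⟩ := (hS _).1 hp
    obtain ⟨-, ⟨-, hzj, hz'⟩, -, hg⟩ := (hS _).1 hq
    dsimp only at hzi hz hf hzj hz' hg
    have hfg : ∀ b ∈ σ, f b = g b := by
      intro b hb
      have h1 := hφ ⟨i, z, f⟩ b hb
      have h2 := hφ ⟨j, z', g⟩ b hb
      rw [heq, h2] at h1
      dsimp only at h1
      have h3 : (f b : ℝ) < g b + 1 ∧ (g b : ℝ) < f b + 1 := by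
        rcases hz b hb with ha | ha <;> rcases hz' b hb with hb | hb
        · constructor <;> linarith [ha.2.1, ha.2.2, hb.2.1, hb.2.2]
        · linarith [ha.1, hb.1]
        · linarith [ha.1, hb.1]
        · constructor <;> linarith [ha.2.1, ha.2.2, hb.2.1, hb.2.2]
      have h4 : f b < g b + 1 := by exact_mod_cast h3.1
      have h5 : g b < f b + 1 := by exact_mod_cast h3.2
      omega
    have hfg' : f = g := by
      ext b
      by_cases hb : b ∈ σ
      · exact hfg b hb
      · rw [Finsupp.notMem_support_iff.1 fun h => hb (hf h),
          Finsupp.notMem_support_iff.1 fun h => hb (hg h)]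
    subst hfg'
    have hzz : z = z' := by simpa [φ] using heq
    subst hzz
    have : i = j := by exact_mod_cast hzi.symm.trans hzj
    subst this
    rfl
  refine ⟨S.image φ, fun x => ?_, ?_⟩
  · rw [Finset.mem_image]
    constructor
    · rintro ⟨p, hp, rfl⟩
      obtain ⟨hpm, ⟨hzΛ, hzi, hz⟩, hsum, -⟩ := (hS _).1 hp
      refine ⟨Λ.add_mem hzΛ (Λ.sum_mem fun b hb => ?_), ?_, fun b hb => ?_⟩
      · rw [Nat.cast_smul_eq_nsmul]
        exact Λ.nsmul_mem (hσΛ b hb) _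
      · have : ∑ b ∈ σ, (p.2.2 b : ℝ) * ht b = ((m - p.1 : ℕ) : ℝ) := by
          rw [← hsum]
          push_cast
          exact Finset.sum_congr rfl fun b hb => by rw [hht b hb, mul_one]
        simp only [φ, map_add, map_sum, map_smul, smul_eq_mul]
        rw [this, hzi]
        push_cast [hpm]
        ring
      · rw [hφ p b hb]
        have : (0 : ℝ) ≤ p.2.2 b := Nat.cast_nonneg _
        rcases hz b hb with h | h
        · rcases (add_nonneg h.2.1 this).lt_or_eq with h' | h'
          · exact Or.inl h'
          · exact Or.inr ⟨h'.symm, h.1⟩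
        · exact Or.inl (by linarith [h.2.1])
    · rintro ⟨hxΛ, hxm, hx⟩
      have hex : ∀ b, ∃ k : ℕ, b ∈ σ →
          (0 < basisCoord σ b y ∧ 0 ≤ basisCoord σ b x - k ∧ basisCoord σ b x - k < 1) ∨
          (basisCoord σ b y < 0 ∧ 0 < basisCoord σ b x - k ∧ basisCoord σ b x - k ≤ 1) := by
        intro b
        by_cases hb : b ∈ σ
        · obtain ⟨k, hk⟩ := exists_nat_split (hy b hb) (hx b hb)
          exact ⟨k, fun _ => hk⟩
        · exact ⟨0, fun h => absurd h hb⟩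
      choose k hk using hex
      let f : E →₀ ℕ := Finsupp.indicator σ fun b _ => k b
      have hf : ∀ b ∈ σ, f b = k b := fun b hb => by simp [f, hb]
      let z : E := x - ∑ b ∈ σ, (f b : ℝ) • b
      have hzc : ∀ b ∈ σ, basisCoord σ b z = basisCoord σ b x - k b := by
        intro b hb
        simp only [z, map_sub]
        rw [hσ.coord_sum (fun b => (f b : ℝ)) hb, hf b hb]
      have hzbox : HalfOpenBox σ y z := fun b hb => by
        rw [hzc b hb]; exact hk b hb
      have hzht : ht z = m - ((∑ b ∈ σ, f b : ℕ) : ℝ) := by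
        simp only [z, map_sub, hxm, map_sum, map_smul, smul_eq_mul]
        push_cast
        congr 1
        exact Finset.sum_congr rfl fun b hb => by rw [hht b hb, mul_one]
      have hznn : 0 ≤ ht z := by
        rw [height_eq_sum_coord hσ hht]
        refine Finset.sum_nonneg fun b hb => ?_
        rcases hzbox b hb with h | h
        · exact h.2.1
        · exact h.2.1.le
      have hle : ∑ b ∈ σ, f b ≤ m := by
        rw [hzht, sub_nonneg] at hznn
        exact_mod_cast hznn
      refine ⟨⟨m - ∑ b ∈ σ, f b, z, f⟩, (hS _).2 ⟨Nat.sub_le _ _, ⟨?_, ?_, hzbox⟩, ?_, ?_⟩, ?_⟩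
      · refine Λ.sub_mem hxΛ (Λ.sum_mem fun b hb => ?_)
        rw [Nat.cast_smul_eq_nsmul]
        exact Λ.nsmul_mem (hσΛ b hb) _
      · rw [hzht]
        push_cast [hle]
        ring
      · dsimp only
        omega
      · exact Finsupp.support_indicator_subset _ _
      · simp [φ, z]
  · rw [Finset.card_image_of_injOn hinj, Finset.card_sigma]
    refine Finset.sum_congr rfl fun i hi => ?_
    have hi : i ≤ m := Nat.lt_succ_iff.1 (Finset.mem_range.1 hi)
    rw [Finset.card_product, Finset.card_finsuppAntidiag_nat_eq_choose, hcard,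
      ← Set.ncard_eq_toFinset_card _ (hbfin i)]
    congr 1
    rw [show n + 1 + (m - i) - 1 = n + (m - i) by omega, show n + m - i = n + (m - i) by omega,
      Nat.choose_symm_add]

/-- Comparison of two expansions in the triangular family `m ↦ (n + m - i).choose n`. -/
theorem eq_of_binomial_expansion {n : ℕ} {a b : ℕ → ℤ}
    (h : ∀ m : ℕ, ∑ i ∈ Finset.range (m + 1), a i * ((n + m - i).choose n : ℤ) =
      ∑ i ∈ Finset.range (m + 1), b i * ((n + m - i).choose n : ℤ)) (i : ℕ) : a i = b i := by
  induction i using Nat.strong_induction_on with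
  | _ m ih =>
    have hm := h m
    rw [Finset.sum_range_succ, Finset.sum_range_succ,
      Finset.sum_congr rfl fun i hi => by rw [ih i (Finset.mem_range.1 hi)]] at hm
    simpa using hm

theorem sum_range_binomial_eq {n : ℕ} {a : ℕ → ℤ} (ha : ∀ i, n < i → a i = 0) (m : ℕ) :
    ∑ i ∈ Finset.range (n + 1), a i * ((n + m - i).choose n : ℤ) =
      ∑ i ∈ Finset.range (m + 1), a i * ((n + m - i).choose n : ℤ) := by
  have h1 : ∑ i ∈ Finset.range (n + 1), a i * ((n + m - i).choose n : ℤ) =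
      ∑ i ∈ Finset.range (n + m + 1), a i * ((n + m - i).choose n : ℤ) := by
    refine Finset.sum_subset (Finset.range_mono (by omega)) fun i _ hi => ?_
    rw [ha i (by simpa using hi), zero_mul]
  have h2 : ∑ i ∈ Finset.range (m + 1), a i * ((n + m - i).choose n : ℤ) =
      ∑ i ∈ Finset.range (n + m + 1), a i * ((n + m - i).choose n : ℤ) := by
    refine Finset.sum_subset (Finset.range_mono (by omega)) fun i hi hi' => ?_
    have h3 : m < i := by simpa using hi'
    have h4 : i < n + m + 1 := Finset.mem_range.1 hi
    rw [Nat.choose_eq_zero_of_lt (by omega)]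
    simp
  rw [h1, h2]

/-- If the Ehrhart series of the cone over `V` has numerator `a`, the coefficient `a i` counts
the lattice points of height `i` in half-open boxes. -/
theorem numerator_eq_box_count {Λ : AddSubgroup E}
    (hfin : ∀ R : ℝ, {x : E | x ∈ Λ ∧ ‖x‖ ≤ R}.Finite) {ht : E →ₗ[ℝ] ℝ} {V : Finset E}
    (hVΛ : ∀ v ∈ V, v ∈ Λ) (hht : ∀ v ∈ V, ht v = 1)
    (hV : Submodule.span ℝ (V : Set E) = ⊤) {n : ℕ} (hn : Module.finrank ℝ E = n + 1)
    {a : ℕ → ℤ} (ha : ∀ i, n < i → a i = 0)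
    (hcount : ∀ m : ℕ, (Set.ncard {x : E | x ∈ Λ ∧ ht x = m ∧ x ∈ genCone V} : ℤ) =
      ∑ i ∈ Finset.range (n + 1), a i * ((n + m - i).choose n : ℤ))
    {ω : E → ℝ} (hω : IsGenericWeight V ω) {y : E} (hy : IsGenericVector V y)
    (hyC : y ∈ genCone V) (hcells : (cellsOf V ω).Finite) (i : ℕ) :
    a i = ∑ σ ∈ hcells.toFinset,
      (Set.ncard {z : E | z ∈ Λ ∧ ht z = i ∧ HalfOpenBox σ y z} : ℤ) := by
  classical
  revert i
  refine eq_of_binomial_expansion (n := n) fun m => ?_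
  have hex : ∀ σ : Finset E, ∃ F : Finset E, σ ∈ cellsOf V ω →
      (∀ x, x ∈ F ↔ x ∈ Λ ∧ ht x = m ∧ HalfOpen σ y x) ∧
      F.card = ∑ i ∈ Finset.range (m + 1),
        Set.ncard {z : E | z ∈ Λ ∧ ht z = i ∧ HalfOpenBox σ y z} * (n + m - i).choose n := by
    intro σ
    by_cases hσ : σ ∈ cellsOf V ω
    · obtain ⟨F, hF⟩ := halfOpen_count hfin hσ.1.2 (fun b hb => hVΛ b (hσ.1.1 hb))
        (fun b hb => hht b (hσ.1.1 hb)) (hσ.1.2.card_eq.trans hn) (hy σ hσ.1) m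
      exact ⟨F, fun _ => hF⟩
    · exact ⟨∅, fun h => absurd h hσ⟩
  choose F hF using hex
  have hset : {x : E | x ∈ Λ ∧ ht x = m ∧ x ∈ genCone V} = (hcells.toFinset.biUnion F : Set E) := by
    ext x
    simp only [Set.mem_ofPred_eq, Finset.coe_biUnion, Set.mem_iUnion, Finset.mem_coe,
      Set.Finite.mem_toFinset, exists_prop]
    constructor
    · rintro ⟨hxΛ, hxm, hx⟩
      obtain ⟨σ, ⟨hσ, hσx⟩, -⟩ := existsUnique_halfOpen hht hV hω hy hyC hx
      exact ⟨σ, hσ, ((hF σ hσ).1 x).2 ⟨hxΛ, hxm, hσx⟩⟩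
    · rintro ⟨σ, hσ, hx⟩
      obtain ⟨hxΛ, hxm, hσx⟩ := ((hF σ hσ).1 x).1 hx
      exact ⟨hxΛ, hxm, hσx.mem_genCone hσ.1⟩
  have hdisj : Set.PairwiseDisjoint (hcells.toFinset : Set (Finset E)) F := by
    intro σ hσ τ hτ hne
    rw [Set.Finite.coe_toFinset] at hσ hτ
    refine Finset.disjoint_left.2 fun x hx hx' => hne ?_
    obtain ⟨-, -, hσx⟩ := ((hF σ hσ).1 x).1 hx
    obtain ⟨-, -, hτx⟩ := ((hF τ hτ).1 x).1 hx'
    exact (existsUnique_halfOpen hht hV hω hy hyC (hσx.mem_genCone hσ.1)).unique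
      ⟨hσ, hσx⟩ ⟨hτ, hτx⟩
  rw [← sum_range_binomial_eq ha m, ← hcount m, hset, Set.ncard_coe_finset,
    Finset.card_biUnion hdisj]
  push_cast
  simp only [Finset.sum_mul]
  rw [Finset.sum_comm]
  refine Finset.sum_congr rfl fun σ hσ => ?_
  rw [(hF σ (hcells.mem_toFinset.1 hσ)).2]
  push_cast
  rfl

/-- Interior lattice points of the cone over `V` have height at least the codegree. -/
theorem codegree_le_height {Λ : AddSubgroup E}
    (hfin : ∀ R : ℝ, {x : E | x ∈ Λ ∧ ‖x‖ ≤ R}.Finite) {ht : E →ₗ[ℝ] ℝ} {V : Finset E}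
    (hVΛ : ∀ v ∈ V, v ∈ Λ) (hht : ∀ v ∈ V, ht v = 1)
    (hV : Submodule.span ℝ (V : Set E) = ⊤) {n : ℕ} (hn : Module.finrank ℝ E = n + 1)
    {a : ℕ → ℤ} {d : ℕ} (hd : d ≤ n) (ha : ∀ i, d < i → a i = 0)
    (hcount : ∀ m : ℕ, (Set.ncard {x : E | x ∈ Λ ∧ ht x = m ∧ x ∈ genCone V} : ℤ) =
      ∑ i ∈ Finset.range (n + 1), a i * ((n + m - i).choose n : ℤ))
    {x : E} (hxΛ : x ∈ Λ) (hxC : x ∈ genCone V) (hx : IsConeInterior V x) {r : ℕ}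
    (hxr : ht x = r) : n + 1 ≤ r + d := by
  classical
  obtain ⟨ω, hω⟩ := exists_isGenericWeight V
  obtain ⟨w, hw⟩ := exists_isGenericVector V
  have hw' : IsGenericVector V (-w) := fun σ hσ b hb => by
    simpa using hw σ hσ b hb
  obtain ⟨t, -, ht1⟩ := hx w
  obtain ⟨t', -, ht2⟩ := hx (-w)
  have hinv : Tendsto (fun δ : ℝ => δ⁻¹) (𝓝[>] 0) atTop := tendsto_inv_nhdsGT_zero
  obtain ⟨δ, ⟨⟨⟨hδ, hδ'⟩, hδt⟩, hδt'⟩, hδ0⟩ :=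
    (((((eventually_coord_sign V hw x).and (eventually_coord_sign V hw' x)).and
      (hinv.eventually_ge_atTop t)).and (hinv.eventually_ge_atTop t')).and
      self_mem_nhdsWithin).exists
  have hδ0 : 0 < δ := hδ0
  have hy : x + δ • -w ∈ genCone V := by
    have := genCone_smul (IsConeInterior.mono_scale hxC ht1 hδt) hδ0.le
    rwa [smul_sub, smul_smul, mul_inv_cancel₀ hδ0.ne', one_smul, sub_eq_add_neg,
      ← smul_neg] at this
  have hz : x + δ • w ∈ genCone V := by
    have := genCone_smul (IsConeInterior.mono_scale hxC ht2 hδt') hδ0.le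
    rwa [smul_sub, smul_smul, mul_inv_cancel₀ hδ0.ne', one_smul, sub_eq_add_neg, smul_neg,
      neg_neg] at this
  obtain ⟨σ, hσ, hpos⟩ := exists_cell hht hV hω hz fun σ hσ b hb => (hδ σ hσ b hb).1
  have hσb := hσ.1.2
  have hσht : ∀ b ∈ σ, ht b = 1 := fun b hb => hht b (hσ.1.1 hb)
  let g : E → ℕ := fun b => if basisCoord σ b x = 0 then 1 else ⌈basisCoord σ b x⌉₊
  let z : E := ∑ b ∈ σ, (g b : ℝ) • b - x
  have hzc : ∀ b ∈ σ, basisCoord σ b z = g b - basisCoord σ b x := by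
    intro b hb
    simp only [z, map_sub]
    rw [hσb.coord_sum (fun b => (g b : ℝ)) hb]
  have hg : ∀ b ∈ σ, 1 ≤ g b := by
    intro b hb
    by_cases h0 : basisCoord σ b x = 0
    · simp [g, h0]
    · simp only [g, h0, if_false]
      rcases (hδ σ hσ.1 b hb).2.1 (hpos b hb) with h | h
      · exact Nat.one_le_ceil_iff.2 h
      · exact absurd h.1 h0
  have hbox : HalfOpenBox σ (x + δ • -w) z := by
    intro b hb
    rw [hzc b hb]
    rcases (hδ σ hσ.1 b hb).2.1 (hpos b hb) with h | ⟨h, h'⟩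
    · left
      refine ⟨(hδ' σ hσ.1 b hb).2.2 (Or.inl h), ?_⟩
      simp only [g, h.ne', if_false]
      have h1 := Nat.ceil_lt_add_one h.le
      have h2 := Nat.le_ceil (basisCoord σ b x)
      constructor <;> linarith
    · right
      refine ⟨?_, ?_⟩
      · simp only [map_add, map_smul, map_neg, h, smul_eq_mul]
        nlinarith
      · simp [g, h]
  have hzΛ : z ∈ Λ := by
    refine Λ.sub_mem (Λ.sum_mem fun b hb => ?_) hxΛ
    rw [Nat.cast_smul_eq_nsmul]
    exact Λ.nsmul_mem (hVΛ b (hσ.1.1 hb)) _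
  have hzht : ht z = ((∑ b ∈ σ, g b : ℕ) : ℝ) - r := by
    simp only [z, map_sub, hxr, map_sum, map_smul, smul_eq_mul]
    push_cast
    congr 1
    exact Finset.sum_congr rfl fun b hb => by rw [hσht b hb, mul_one]
  have hznn : 0 ≤ ht z := by
    rw [height_eq_sum_coord hσb hσht]
    refine Finset.sum_nonneg fun b hb => ?_
    rcases hbox b hb with h | h
    · exact h.2.1
    · exact h.2.1.le
  have hle : r ≤ ∑ b ∈ σ, g b := by
    rw [hzht, sub_nonneg] at hznn
    exact_mod_cast hznn
  have hge : n + 1 ≤ ∑ b ∈ σ, g b := by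
    rw [← hn, ← hσb.card_eq, Finset.card_eq_sum_ones]
    exact Finset.sum_le_sum hg
  by_contra hlt
  have hcells : (cellsOf V ω).Finite := (basesOf_finite V).subset fun σ hσ => hσ.1
  have hnum := numerator_eq_box_count hfin hVΛ hht hV hn (fun i hi => ha i (hd.trans_lt hi))
    hcount hω (fun σ hσ b hb => (hδ' σ hσ b hb).1) hy hcells (∑ b ∈ σ, g b - r)
  rw [ha _ (by omega)] at hnum
  have h0 := (Finset.sum_eq_zero_iff_of_nonneg fun σ _ => Int.natCast_nonneg _).1 hnum.symm σ
    (hcells.mem_toFinset.2 hσ)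
  rw [Nat.cast_eq_zero, Set.ncard_eq_zero
    ((halfOpenBox_finite hfin hσb _).subset fun z hz => ⟨hz.1, hz.2.2⟩)] at h0
  refine (Set.eq_empty_iff_forall_notMem.1 h0) z ⟨hzΛ, ?_, hbox⟩
  rw [hzht]
  push_cast [hle]
  ring

end HalfOpenDecomposition

section NonintegralCoordinates

variable {E : Type*} [NormedAddCommGroup E] [NormedSpace ℝ E]

/-- The representative of `x` modulo the lattice spanned by the basis `σ` in the half-open
fundamental parallelepiped. -/
def fractBox (σ : Finset E) (x : E) : E :=
  ∑ b ∈ σ, Int.fract (basisCoord σ b x) • b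

theorem coord_fractBox {σ : Finset E} (hσ : IsBasisSet σ) (x : E) {b : E} (hb : b ∈ σ) :
    basisCoord σ b (fractBox σ x) = Int.fract (basisCoord σ b x) :=
  hσ.coord_sum _ hb

theorem fractBox_mem {Λ : AddSubgroup E} {σ : Finset E} (hσ : IsBasisSet σ)
    (hσΛ : ∀ b ∈ σ, b ∈ Λ) {x : E} (hx : x ∈ Λ) : fractBox σ x ∈ Λ := by
  have h : fractBox σ x = x - ∑ b ∈ σ, ⌊basisCoord σ b x⌋ • b := by
    conv_rhs => rw [← hσ.sum_coord x]
    rw [← Finset.sum_sub_distrib, hσ.sum_coord x]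
    refine Finset.sum_congr rfl fun b _ => ?_
    rw [← Int.cast_smul_eq_zsmul ℝ, ← sub_smul, Int.self_sub_floor]
  rw [h]
  exact Λ.sub_mem hx (Λ.sum_mem fun b hb => Λ.zsmul_mem (hσΛ b hb) _)

theorem isConeInterior_of_coord_pos {V σ : Finset E} (hσ : IsBasisSet σ) (hσV : σ ⊆ V) {z : E}
    (hz : ∀ b ∈ σ, 0 < basisCoord σ b z) : IsConeInterior V z := by
  intro w
  refine ⟨∑ b ∈ σ, |basisCoord σ b w| / basisCoord σ b z,
    Finset.sum_nonneg fun b hb => div_nonneg (abs_nonneg _) (hz b hb).le, genCone_mono hσV ?_⟩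
  refine ⟨fun b => basisCoord σ b _, fun b hb => ?_, hσ.sum_coord _⟩
  have h1 : |basisCoord σ b w| / basisCoord σ b z ≤
      ∑ b ∈ σ, |basisCoord σ b w| / basisCoord σ b z :=
    Finset.single_le_sum (f := fun b => |basisCoord σ b w| / basisCoord σ b z)
      (fun b hb => div_nonneg (abs_nonneg _) (hz b hb).le) hb
  rw [div_le_iff₀ (hz b hb)] at h1
  dsimp only
  rw [map_sub, map_smul, smul_eq_mul, sub_nonneg]
  exact (le_abs_self _).trans h1

/-- In a lattice polytope of degree `d`, the fractional coordinates of a lattice point with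
respect to a simplex have sum at most `d`. -/
theorem sum_coord_le {Λ : AddSubgroup E} {ht : E →ₗ[ℝ] ℝ} {V : Finset E}
    (hVΛ : ∀ v ∈ V, v ∈ Λ) (hht : ∀ v ∈ V, ht v = 1) (hinteger : ∀ x ∈ Λ, ∃ k : ℤ, ht x = k)
    {n d : ℕ} (hn : Module.finrank ℝ E = n + 1)
    (hcodeg : ∀ x ∈ Λ, x ∈ genCone V → IsConeInterior V x → ∀ r : ℕ, ht x = r → n + 1 ≤ r + d)
    {σ : Finset E} (hσ : IsBasisSet σ) (hσV : σ ⊆ V) {y : E} (hy : y ∈ Λ)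
    (hy1 : ∀ b ∈ σ, basisCoord σ b y < 1) : ∑ b ∈ σ, basisCoord σ b y ≤ d := by
  set z : E := ∑ b ∈ σ, b - y with hz
  have hzΛ : z ∈ Λ := Λ.sub_mem (Λ.sum_mem fun b hb => hVΛ b (hσV hb)) hy
  have hzc : ∀ b ∈ σ, basisCoord σ b z = 1 - basisCoord σ b y := fun b hb => by
    have := hσ.coord_sum (fun _ => 1) hb
    simp only [one_smul] at this
    rw [hz, map_sub, this]
  have hpos : ∀ b ∈ σ, 0 < basisCoord σ b z := fun b hb => by
    rw [hzc b hb]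
    linarith [hy1 b hb]
  have hzC : z ∈ genCone V :=
    genCone_mono hσV ⟨fun b => basisCoord σ b z, fun b hb => (hpos b hb).le, hσ.sum_coord z⟩
  have hzht : ht z = (n + 1 : ℝ) - ∑ b ∈ σ, basisCoord σ b y := by
    rw [height_eq_sum_coord hσ (fun v hv => hht v (hσV hv)) z, Finset.sum_congr rfl hzc,
      Finset.sum_sub_distrib, Finset.sum_const, hσ.card_eq, hn]
    simp
  obtain ⟨k, hk⟩ := hinteger z hzΛ
  have hk0 : 0 ≤ k := by
    have : (0 : ℝ) ≤ k := by
      rw [← hk, height_eq_sum_coord hσ (fun v hv => hht v (hσV hv)) z]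
      exact Finset.sum_nonneg fun b hb => (hpos b hb).le
    exact_mod_cast this
  lift k to ℕ using hk0
  have h := hcodeg z hzΛ hzC (isConeInterior_of_coord_pos hσ hσV hpos) k (by rw [hk]; simp)
  have h' : (n + 1 : ℝ) ≤ k + d := by exact_mod_cast h
  rw [hzht] at hk
  push_cast at hk
  linarith

open Classical in
/-- At most `4d` coordinate functionals of a simplex in a lattice polytope of degree `d` fail
to be integral on the lattice. -/
theorem card_nonintegral_le {Λ : AddSubgroup E}
    (hfin : ∀ R : ℝ, {x : E | x ∈ Λ ∧ ‖x‖ ≤ R}.Finite) {ht : E →ₗ[ℝ] ℝ} {V : Finset E}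
    (hVΛ : ∀ v ∈ V, v ∈ Λ) (hht : ∀ v ∈ V, ht v = 1) (hinteger : ∀ x ∈ Λ, ∃ k : ℤ, ht x = k)
    {n d : ℕ} (hn : Module.finrank ℝ E = n + 1)
    (hcodeg : ∀ x ∈ Λ, x ∈ genCone V → IsConeInterior V x → ∀ r : ℕ, ht x = r → n + 1 ≤ r + d)
    {σ : Finset E} (hσ : IsBasisSet σ) (hσV : σ ⊆ V) :
    (σ.filter fun b => ¬ ∀ x ∈ Λ, ∃ k : ℤ, basisCoord σ b x = k).card ≤ 4 * d := by
  have hσΛ : ∀ b ∈ σ, b ∈ Λ := fun b hb => hVΛ b (hσV hb)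
  have hFfin : {z : E | z ∈ Λ ∧ ∀ b ∈ σ, 0 ≤ basisCoord σ b z ∧ basisCoord σ b z < 1}.Finite := by
    refine (halfOpenBox_finite hfin hσ (∑ b ∈ σ, b)).subset ?_
    rintro z ⟨hz, hzb⟩
    refine ⟨hz, fun b hb => Or.inl ⟨?_, hzb b hb⟩⟩
    have := hσ.coord_sum (fun _ => 1) hb
    simp only [one_smul] at this
    rw [this]
    exact one_pos
  set F := hFfin.toFinset with hF
  have hmem : ∀ z, z ∈ F ↔
      z ∈ Λ ∧ ∀ b ∈ σ, 0 ≤ basisCoord σ b z ∧ basisCoord σ b z < 1 := fun z => by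
    rw [hF, Set.Finite.mem_toFinset, Set.mem_ofPred_eq]
  have hfract : ∀ x ∈ Λ, fractBox σ x ∈ F := fun x hx => by
    refine (hmem _).2 ⟨fractBox_mem hσ hσΛ hx, fun b hb => ?_⟩
    rw [coord_fractBox hσ x hb]
    exact ⟨Int.fract_nonneg _, Int.fract_lt_one _⟩
  have hself : ∀ z ∈ F, ∀ b ∈ σ, Int.fract (basisCoord σ b z) = basisCoord σ b z :=
    fun z hz b hb => Int.fract_eq_self.2 (((hmem z).1 hz).2 b hb)
  have hneg : ∀ b ∈ σ, 2 * ∑ z ∈ F, basisCoord σ b z =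
      (F.filter fun z => basisCoord σ b z ≠ 0).card := by
    intro b hb
    have hinv : ∑ z ∈ F, basisCoord σ b (fractBox σ (-z)) = ∑ z ∈ F, basisCoord σ b z := by
      refine Finset.sum_nbij' (fun z => fractBox σ (-z)) (fun z => fractBox σ (-z))
        (fun z hz => hfract _ (Λ.neg_mem ((hmem z).1 hz).1))
        (fun z hz => hfract _ (Λ.neg_mem ((hmem z).1 hz).1)) ?_ ?_ (fun _ _ => rfl) <;>
      · intro z hz
        refine hσ.ext_coord fun c hc => ?_
        rw [coord_fractBox hσ _ hc, map_neg, coord_fractBox hσ _ hc, map_neg]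
        conv_rhs => rw [← hself z hz c hc]
        rw [Int.fract_eq_fract]
        refine ⟨⌊-basisCoord σ c z⌋, ?_⟩
        rw [← Int.self_sub_floor]
        ring
    have hpair : ∑ z ∈ F, (basisCoord σ b z + basisCoord σ b (fractBox σ (-z))) =
        ∑ z ∈ F, if basisCoord σ b z ≠ 0 then (1 : ℝ) else 0 := by
      refine Finset.sum_congr rfl fun z hz => ?_
      rw [coord_fractBox hσ _ hb, map_neg]
      split_ifs with h
      · rw [Int.fract_neg (by rwa [hself z hz b hb]), hself z hz b hb]
        ring
      · rw [not_not] at h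
        simp [h]
    rw [Finset.sum_add_distrib, hinv, ← two_mul, Finset.sum_boole] at hpair
    exact hpair
  have hU : ∀ b ∈ σ, (¬ ∀ x ∈ Λ, ∃ k : ℤ, basisCoord σ b x = k) →
      (F.card : ℝ) ≤ 4 * ∑ z ∈ F, basisCoord σ b z := by
    intro b hb hbU
    push Not at hbU
    obtain ⟨g, hg, hgb⟩ := hbU
    have hle : (F.filter fun z => ¬ basisCoord σ b z ≠ 0).card ≤
        (F.filter fun z => basisCoord σ b z ≠ 0).card := by
      refine Finset.card_le_card_of_injOn (fun z => fractBox σ (z + g)) ?_ ?_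
      · intro z hz
        obtain ⟨hz, hz0⟩ := Finset.mem_filter.1 hz
        rw [not_not] at hz0
        refine Finset.mem_filter.2 ⟨hfract _ (Λ.add_mem ((hmem z).1 hz).1 hg), ?_⟩
        rw [coord_fractBox hσ _ hb, map_add, hz0, zero_add]
        intro h0
        refine hgb ⌊basisCoord σ b g⌋ ?_
        conv_lhs => rw [← Int.floor_add_fract (basisCoord σ b g), h0, add_zero]
      · intro z hz z' hz' heq
        have hz := (Finset.mem_filter.1 hz).1
        have hz' := (Finset.mem_filter.1 hz').1
        refine hσ.ext_coord fun c hc => ?_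
        have h := congrArg (basisCoord σ c) heq
        dsimp only at h
        rw [coord_fractBox hσ _ hc, coord_fractBox hσ _ hc, map_add, map_add,
          Int.fract_eq_fract] at h
        rw [← hself z hz c hc, ← hself z' hz' c hc, Int.fract_eq_fract]
        obtain ⟨k, hk⟩ := h
        exact ⟨k, by rw [← hk]; ring⟩
    have hsum := Finset.card_filter_add_card_filter_not (s := F) fun z => basisCoord σ b z ≠ 0
    have h2 := hneg b hb
    have h3 : F.card ≤ 2 * (F.filter fun z => basisCoord σ b z ≠ 0).card := by
      omega
    have h3 : (F.card : ℝ) ≤ 2 * (F.filter fun z => basisCoord σ b z ≠ 0).card := by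
      exact_mod_cast h3
    linarith
  have h0 : 0 < F.card := Finset.card_pos.2 ⟨0, (hmem 0).2 ⟨Λ.zero_mem, fun b _ => by simp⟩⟩
  have htot : ∑ b ∈ σ.filter (fun b => ¬ ∀ x ∈ Λ, ∃ k : ℤ, basisCoord σ b x = k), (F.card : ℝ) ≤
      4 * (F.card * d) := by
    calc _ ≤ ∑ b ∈ σ.filter (fun b => ¬ ∀ x ∈ Λ, ∃ k : ℤ, basisCoord σ b x = k),
          4 * ∑ z ∈ F, basisCoord σ b z :=
          Finset.sum_le_sum fun b hb =>
            hU b (Finset.mem_filter.1 hb).1 (Finset.mem_filter.1 hb).2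
      _ ≤ ∑ b ∈ σ, 4 * ∑ z ∈ F, basisCoord σ b z :=
          Finset.sum_le_sum_of_subset_of_nonneg (Finset.filter_subset _ _) fun b hb _ =>
            mul_nonneg (by norm_num) (Finset.sum_nonneg fun z hz => (((hmem z).1 hz).2 b hb).1)
      _ = 4 * ∑ z ∈ F, ∑ b ∈ σ, basisCoord σ b z := by
          rw [← Finset.mul_sum, Finset.sum_comm]
      _ ≤ 4 * ∑ z ∈ F, (d : ℝ) := by
          gcongr with z hz
          exact sum_coord_le hVΛ hht hinteger hn hcodeg hσ hσV ((hmem z).1 hz).1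
            fun b hb => (((hmem z).1 hz).2 b hb).2
      _ = _ := by rw [Finset.sum_const, nsmul_eq_mul]
  rw [Finset.sum_const, nsmul_eq_mul] at htot
  have h0' : (0 : ℝ) < F.card := by exact_mod_cast h0
  have : ((σ.filter fun b => ¬ ∀ x ∈ Λ, ∃ k : ℤ, basisCoord σ b x = k).card : ℝ) ≤ 4 * d := by
    refine le_of_mul_le_mul_right ?_ h0'
    linarith
  exact_mod_cast this

end NonintegralCoordinates

section InteriorSubsets

open Classical

variable {E : Type*} [AddCommGroup E] [Module ℝ E]

/-- The image of a finitely generated cone under a linear map of finite rank satisfies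
Carathéodory's theorem. -/
theorem exists_small_genCone {F : Type*} [AddCommGroup F] [Module ℝ F] [FiniteDimensional ℝ F]
    (π : E →ₗ[ℝ] F) (D : Finset E) {x : E} (hx : x ∈ genCone D) :
    ∃ D' ⊆ D, D'.card ≤ Module.finrank ℝ F ∧ ∃ y ∈ genCone D', π y = π x := by
  induction hm : D.card using Nat.strong_induction_on generalizing D x with
  | _ m ih =>
    by_cases hcard : D.card ≤ Module.finrank ℝ F
    · exact ⟨D, Finset.Subset.refl D, hcard, x, hx, rfl⟩
    have hdep : ¬ LinearIndepOn ℝ π (D : Set E) := fun hli => by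
      have := LinearIndependent.fintype_card_le_finrank hli
      simp at this
      omega
    rw [linearIndepOn_finset_iff] at hdep
    push Not at hdep
    obtain ⟨g, hg, v, hvD, hgv⟩ := hdep
    obtain ⟨g, hg, v, hvD, hgv⟩ : ∃ g : E → ℝ, ∑ i ∈ D, g i • π i = 0 ∧ ∃ v ∈ D, 0 < g v := by
      rcases lt_or_gt_of_ne hgv with h | h
      · exact ⟨fun i => -g i, by simp [hg], v, hvD, neg_pos.2 h⟩
      · exact ⟨g, hg, v, hvD, h⟩
    obtain ⟨c, hc, rfl⟩ := hx
    obtain ⟨w, hw, hmin⟩ := (D.filter fun v => 0 < g v).exists_min_image (fun v => c v / g v)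
      ⟨v, Finset.mem_filter.2 ⟨hvD, hgv⟩⟩
    obtain ⟨hwD, hgw⟩ := Finset.mem_filter.1 hw
    have hc0 : ∀ v ∈ D, 0 ≤ c v - c w / g w * g v := by
      intro v hv
      by_cases h : 0 < g v
      · have := hmin v (Finset.mem_filter.2 ⟨hv, h⟩)
        rw [le_div_iff₀ h] at this
        linarith
      · have h1 : 0 ≤ c w / g w := div_nonneg (hc w hwD) hgw.le
        nlinarith [hc v hv, mul_nonneg h1 (neg_nonneg.2 (not_lt.1 h))]
    obtain ⟨D', hD', hD'c, y, hy, hπ⟩ := ih (D.erase w).card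
      (by rw [Finset.card_erase_of_mem hwD]; have := Finset.card_pos.2 ⟨w, hwD⟩; omega)
      (D.erase w) (x := ∑ v ∈ D.erase w, (c v - c w / g w * g v) • v)
      ⟨_, fun v hv => hc0 v (Finset.mem_of_mem_erase hv), rfl⟩ rfl
    refine ⟨D', hD'.trans (Finset.erase_subset _ _), hD'c, y, hy, ?_⟩
    have h0 : (c w - c w / g w * g w) • w = 0 := by
      rw [div_mul_cancel₀ _ hgw.ne', sub_self, zero_smul]
    rw [hπ, Finset.sum_erase (f := fun v => (c v - c w / g w * g v) • v) D h0, map_sum, map_sum]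
    simp only [map_sub, map_smul, sub_smul, mul_smul, Finset.sum_sub_distrib, ← Finset.smul_sum, hg,
      smul_zero, sub_zero]

/-- A subset of `V` of minimal size whose sum lies in the interior of the cone over `V`: every
point of the cone in its span has nonnegative coordinates. -/
theorem exists_minimal_interior {V : Finset E} (hV : Submodule.span ℝ (V : Set E) = ⊤) :
    ∃ J ⊆ V, IsConeInterior V (∑ v ∈ J, v) ∧
      ∀ a : E → ℝ, ∑ b ∈ J, a b • b ∈ genCone V → ∀ b ∈ J, 0 ≤ a b := by
  obtain ⟨J, hJ, hmin⟩ :=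
    (V.powerset.filter fun J => IsConeInterior V (∑ v ∈ J, v)).exists_min_image
    Finset.card ⟨V, Finset.mem_filter.2 ⟨Finset.mem_powerset_self V, isConeInterior_sum hV⟩⟩
  obtain ⟨hJV, hJ⟩ := Finset.mem_filter.1 hJ
  rw [Finset.mem_powerset] at hJV
  refine ⟨J, hJV, hJ, fun a ha b hb => ?_⟩
  by_contra hab
  set S := J.filter fun b => 0 ≤ a b with hS
  have hSJ : S ⊆ J := Finset.filter_subset _ _
  have hface : ∀ c ∈ J, c ∈ faceOf V S := by
    intro c hc
    by_cases hac : 0 ≤ a c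
    · exact mem_faceOf_of_mem (hSJ.trans hJV) (Finset.mem_filter.2 ⟨hc, hac⟩)
    have h1 : ∑ b ∈ S, a b • b ∈ faceOf V S :=
      genCone_subset_faceOf (hSJ.trans hJV) ⟨a, fun v hv => (Finset.mem_filter.1 hv).2, rfl⟩
    refine mem_faceOf_of_smul_mem (r := -a c) (by linarith) (mem_faceOf_of_sub_mem h1 ?_)
    have hcN : c ∈ J.filter fun b => ¬ 0 ≤ a b := Finset.mem_filter.2 ⟨hc, hac⟩
    have h2 : ∑ b ∈ S, a b • b - (-a c) • c = ∑ b ∈ J, a b • b +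
        ∑ b ∈ (J.filter fun b => ¬ 0 ≤ a b).erase c, (-a b) • b := by
      rw [← Finset.sum_filter_add_sum_filter_not J fun b => 0 ≤ a b,
        ← Finset.add_sum_erase _ _ hcN]
      simp only [neg_smul, Finset.sum_neg_distrib, sub_neg_eq_add]
      abel
    rw [h2]
    refine genCone_add ha (genCone_sum _ _ fun v hv => genCone_smul (mem_genCone_of_mem ?_) ?_)
    · exact hJV (Finset.mem_filter.1 (Finset.mem_of_mem_erase hv)).1
    · have := (Finset.mem_filter.1 (Finset.mem_of_mem_erase hv)).2
      linarith
  have hlt : S.card < J.card :=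
    Finset.card_lt_card ⟨hSJ, fun h => hab (Finset.mem_filter.1 (h hb)).2⟩
  exact absurd (hmin S (Finset.mem_filter.2 ⟨Finset.mem_powerset.2 (hSJ.trans hJV),
    hJ.of_faceOf (faceOf_sum J _ hface)⟩)) (by omega)

theorem linearIndepOn_of_nonneg {V J : Finset E}
    (hP : ∀ a : E → ℝ, ∑ b ∈ J, a b • b ∈ genCone V → ∀ b ∈ J, 0 ≤ a b) :
    LinearIndepOn ℝ id (J : Set E) := by
  rw [linearIndepOn_finset_iff]
  intro a ha b hb
  simp only [id] at ha
  have h1 := hP a (by rw [ha]; exact zero_mem_genCone V) b hb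
  have h2 := hP (fun b => -a b) (by simp [ha, zero_mem_genCone]) b hb
  linarith

/-- There is a small subset `B` of `V` such that every point of the cone can be moved into the
simplicial cone over `J` by adding a point of the cone over `B`. -/
theorem exists_complement [FiniteDimensional ℝ E] {V J : Finset E}
    (hV : Submodule.span ℝ (V : Set E) = ⊤) (hJV : J ⊆ V) (hJ : IsConeInterior V (∑ v ∈ J, v))
    (hP : ∀ a : E → ℝ, ∑ b ∈ J, a b • b ∈ genCone V → ∀ b ∈ J, 0 ≤ a b) :
    ∃ B ⊆ V, B.card + 2 * J.card ≤ 2 * Module.finrank ℝ E ∧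
      Submodule.span ℝ (J ∪ B : Set E) = ⊤ ∧
      ∀ x ∈ genCone V, ∃ e ∈ genCone B, ∃ a : E → ℝ, (∀ b ∈ J, 0 ≤ a b) ∧
        x + e = ∑ b ∈ J, a b • b := by
  obtain ⟨σ, hJσ, hσV, hσ⟩ := exists_isBasisSet_between hJV (linearIndepOn_of_nonneg hP) hV
  obtain ⟨t, -, ht⟩ := hJ (∑ b ∈ σ \ J, b)
  obtain ⟨D, hDV, hDc, δ, hδ, hπ⟩ :=
    exists_small_genCone (Submodule.span ℝ (J : Set E)).mkQ V ht
  have hfr : Module.finrank ℝ (E ⧸ Submodule.span ℝ (J : Set E)) + J.card =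
      Module.finrank ℝ E := by
    rw [← Submodule.finrank_quotient_add_finrank (Submodule.span ℝ (J : Set E)),
      finrank_span_finset_eq_card (linearIndepOn_of_nonneg hP)]
  have hcard : (σ \ J).card + J.card = σ.card := Finset.card_sdiff_add_card_eq_card hJσ
  rw [hσ.card_eq] at hcard
  have hBV : σ \ J ∪ D ⊆ V := Finset.union_subset (Finset.sdiff_subset.trans hσV) hDV
  have hspan : ∑ b ∈ σ \ J, b + δ ∈ Submodule.span ℝ (J : Set E) := by
    have h1 : t • ∑ v ∈ J, v ∈ Submodule.span ℝ (J : Set E) :=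
      Submodule.smul_mem _ _ (Submodule.sum_mem _ fun v hv => Submodule.subset_span hv)
    have h2 : δ - (t • ∑ v ∈ J, v - ∑ b ∈ σ \ J, b) ∈ Submodule.span ℝ (J : Set E) :=
      (Submodule.Quotient.eq _).1 hπ
    convert Submodule.add_mem _ h2 h1 using 1
    abel
  refine ⟨σ \ J ∪ D, hBV, ?_, ?_, ?_⟩
  · have := Finset.card_union_le (σ \ J) D
    omega
  · rw [eq_top_iff, ← hσ.span_eq]
    refine Submodule.span_mono fun v hv => ?_
    by_cases hvJ : v ∈ J
    · exact Or.inl hvJ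
    · refine Or.inr ?_
      simp [hvJ, Finset.mem_coe.1 hv]
  · intro x hx
    set τ := ∑ b ∈ σ \ J, |basisCoord σ b x| with hτ
    have hτ0 : 0 ≤ τ := Finset.sum_nonneg fun b _ => abs_nonneg _
    have he : ∑ b ∈ σ \ J, (τ - basisCoord σ b x) • b + τ • δ ∈ genCone (σ \ J ∪ D) := by
      refine genCone_add (genCone_sum _ _ fun b hb => genCone_smul
        (mem_genCone_of_mem (Finset.mem_union_left _ hb)) ?_)
        (genCone_smul (genCone_mono Finset.subset_union_right hδ) hτ0)
      have : |basisCoord σ b x| ≤ τ :=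
        Finset.single_le_sum (f := fun b => |basisCoord σ b x|) (fun b _ => abs_nonneg _) hb
      linarith [le_abs_self (basisCoord σ b x)]
    have hsum : x + (∑ b ∈ σ \ J, (τ - basisCoord σ b x) • b + τ • δ) =
        ∑ b ∈ J, basisCoord σ b x • b + τ • (∑ b ∈ σ \ J, b + δ) := by
      have hx' := hσ.sum_coord x
      rw [← Finset.sum_sdiff hJσ] at hx'
      nth_rewrite 1 [← hx']
      simp only [sub_smul, Finset.sum_sub_distrib, smul_add, Finset.smul_sum]
      abel
    have hmem : x + (∑ b ∈ σ \ J, (τ - basisCoord σ b x) • b + τ • δ) ∈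
        Submodule.span ℝ (J : Set E) := by
      rw [hsum]
      exact Submodule.add_mem _ (Submodule.sum_mem _ fun b hb =>
        Submodule.smul_mem _ _ (Submodule.subset_span hb)) (Submodule.smul_mem _ _ hspan)
    obtain ⟨a, -, ha⟩ := Submodule.mem_span_finset.1 hmem
    refine ⟨_, he, a, hP a ?_, ha.symm⟩
    rw [ha]
    exact genCone_add hx (genCone_mono hBV he)

/-- The number of elements of `J` in the smallest face containing `X`. -/
def faceCount (V J X : Finset E) : ℕ := (J.filter fun b => b ∈ faceOf V X).card

theorem faceCount_le {V J X : Finset E} (hJV : J ⊆ V) (hXV : X ⊆ V)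
    (hJ : IsConeInterior V (∑ v ∈ J, v)) {n d : ℕ}
    (hcodeg : ∀ S ⊆ V, IsConeInterior V (∑ v ∈ S, v) → n + 1 ≤ S.card + d) :
    n + 1 + faceCount V J X ≤ X.card + J.card + d := by
  set S := X ∪ J.filter fun b => b ∉ faceOf V X with hS
  have hSV : S ⊆ V := Finset.union_subset hXV ((Finset.filter_subset _ _).trans hJV)
  have h := hcodeg S hSV (hJ.of_faceOf (faceOf_sum J _ fun b hb => ?_))
  · have h1 := Finset.card_union_le X (J.filter fun b => b ∉ faceOf V X)
    have h2 := Finset.card_filter_add_card_filter_not (s := J) fun b => b ∈ faceOf V X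
    rw [← hS] at h1
    rw [faceCount]
    omega
  · by_cases hbX : b ∈ faceOf V X
    · exact faceOf_mono Finset.subset_union_left hSV hbX
    · exact mem_faceOf_of_mem hSV (Finset.mem_union_right _ (Finset.mem_filter.2 ⟨hb, hbX⟩))

/-- A superset `X` of `B` whose face contains few elements of `J`, and whose face grows by at most
one element of `J` whenever a single point is added to `X`. -/
theorem exists_saturated {V J B : Finset E} (hJV : J ⊆ V) (hBV : B ⊆ V)
    (hJ : IsConeInterior V (∑ v ∈ J, v)) {n d : ℕ}
    (hcodeg : ∀ S ⊆ V, IsConeInterior V (∑ v ∈ S, v) → n + 1 ≤ S.card + d) :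
    ∃ X, B ⊆ X ∧ X ⊆ V ∧ faceCount V J X + 2 * (n + 1) ≤ 2 * (B.card + J.card + d) ∧
      ∀ v ∈ V, faceCount V J (insert v X) ≤ faceCount V J X + 1 := by
  obtain ⟨X, hX, hmax⟩ := (V.powerset.filter fun X =>
    B ⊆ X ∧ 2 * X.card ≤ faceCount V J X + 2 * B.card).exists_max_image Finset.card
    ⟨B, Finset.mem_filter.2 ⟨Finset.mem_powerset.2 hBV, Finset.Subset.refl B, by omega⟩⟩
  obtain ⟨hXV, hBX, hXc⟩ := Finset.mem_filter.1 hX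
  rw [Finset.mem_powerset] at hXV
  have hle := faceCount_le hJV hXV hJ hcodeg
  refine ⟨X, hBX, hXV, by omega, fun v hv => ?_⟩
  by_cases hvX : v ∈ X
  · rw [Finset.insert_eq_of_mem hvX]
    omega
  by_contra hlt
  have hc := Finset.card_insert_of_notMem hvX
  have := hmax (insert v X) (Finset.mem_filter.2 ⟨Finset.mem_powerset.2
    (Finset.insert_subset hv hXV), hBX.trans (Finset.subset_insert _ _), by omega⟩)
  omega

end InteriorSubsets

section DualFunctionals

open Classical

variable {E : Type*} [NormedAddCommGroup E] [NormedSpace ℝ E]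

/-- The points of `J` outside the face of `X` are separated from the remaining points of `J` and
from `X` by functionals which are nonnegative on the cone, provided every point of the cone can be
moved into the simplicial cone over `J` by adding a point of the cone over `X`. -/
theorem exists_dual_functional {V J X : Finset E} (hXV : X ⊆ V) (hJV : J ⊆ V)
    (hP : ∀ a : E → ℝ, ∑ b ∈ J, a b • b ∈ genCone V → ∀ b ∈ J, 0 ≤ a b)
    (hQ : ∀ x ∈ genCone V, ∃ e ∈ genCone X, ∃ a : E → ℝ, (∀ b ∈ J, 0 ≤ a b) ∧
      x + e = ∑ b ∈ J, a b • b) {b : E} (hb : b ∈ J) (hbX : b ∉ faceOf V X) :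
    ∃ f : E →ₗ[ℝ] ℝ, f b = 1 ∧ (∀ x ∈ X, f x = 0) ∧ (∀ c ∈ J, c ≠ b → f c = 0) ∧
      (∀ v ∈ V, 0 ≤ f v) ∧ ∀ v ∈ V, f v ≠ 0 → b ∈ faceOf V (insert v X) := by
  have hface : ∀ {Y : Finset E} {y : E} {a : E → ℝ}, y ∈ faceOf V Y → (∀ c ∈ J, 0 ≤ a c) →
      y = ∑ c ∈ J, a c • c → 0 < a b → b ∈ faceOf V Y := by
    intro Y y a hy ha hya hab
    refine mem_faceOf_of_smul_mem hab (mem_faceOf_of_sub_mem hy ?_)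
    rw [hya, ← Finset.add_sum_erase J _ hb, add_sub_cancel_left]
    exact genCone_sum _ _ fun c hc => genCone_smul
      (mem_genCone_of_mem (hJV (Finset.mem_of_mem_erase hc))) (ha c (Finset.mem_of_mem_erase hc))
  have hspan : b ∉ Submodule.span ℝ (X ∪ J.erase b : Set E) := by
    intro h
    rw [Submodule.span_union] at h
    obtain ⟨x, hx, j, hj, hxj⟩ := Submodule.mem_sup.1 h
    obtain ⟨c, -, rfl⟩ := Submodule.mem_span_finset.1 hx
    obtain ⟨g, -, rfl⟩ := Submodule.mem_span_finset.1 hj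
    have h1 : ∑ v ∈ X, max (c v) 0 • v ∈ genCone X := ⟨_, fun v _ => le_max_right _ _, rfl⟩
    have h2 : ∑ v ∈ X, max (-c v) 0 • v ∈ genCone X := ⟨_, fun v _ => le_max_right _ _, rfl⟩
    have h12 : ∑ v ∈ X, max (c v) 0 • v = ∑ v ∈ X, c v • v + ∑ v ∈ X, max (-c v) 0 • v := by
      rw [← Finset.sum_add_distrib]
      refine Finset.sum_congr rfl fun v _ => ?_
      rw [← add_smul]
      congr 1
      rcases le_total (c v) 0 with h | h
      · rw [max_eq_right h, max_eq_left (by linarith)]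
        ring
      · rw [max_eq_left h, max_eq_right (by linarith)]
        ring
    obtain ⟨e, he, a, ha, hea⟩ := hQ _ (genCone_mono hXV h2)
    have hsum : ∑ v ∈ X, max (c v) 0 • v + e =
        ∑ v ∈ J, (a v + if v = b then 1 else -g v) • v := by
      have h3 : ∑ v ∈ J, (if v = b then (1 : ℝ) else -g v) • v =
          b - ∑ v ∈ J.erase b, g v • v := by
        rw [← Finset.add_sum_erase J _ hb, if_pos rfl, one_smul, sub_eq_add_neg,
          ← Finset.sum_neg_distrib]
        congr 1
        refine Finset.sum_congr rfl fun v hv => ?_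
        rw [if_neg (Finset.ne_of_mem_erase hv), neg_smul]
      simp only [add_smul, Finset.sum_add_distrib]
      rw [h3, sub_eq_of_eq_add hxj.symm, ← hea, h12]
      abel
    have hmem : ∑ v ∈ X, max (c v) 0 • v + e ∈ genCone X := genCone_add h1 he
    refine hbX (hface (genCone_subset_faceOf hXV hmem) (hP _ ?_) hsum ?_)
    · rw [← hsum]
      exact genCone_mono hXV hmem
    · rw [if_pos rfl]
      linarith [ha b hb]
  obtain ⟨f, hfb, hf⟩ := Submodule.exists_le_ker_of_notMem hspan
  have hf0 : ∀ v, v ∈ X ∨ v ∈ J.erase b → f v = 0 := fun v hv =>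
    hf (Submodule.subset_span hv)
  have hfX : ∀ v ∈ X, f v = 0 := fun v hv => hf0 v (Or.inl hv)
  have hfe : ∀ e ∈ genCone X, f e = 0 := by
    rintro e ⟨c, -, rfl⟩
    rw [map_sum]
    exact Finset.sum_eq_zero fun v hv => by rw [map_smul, hfX v hv, smul_zero]
  have hfJ : ∀ c ∈ J, c ≠ b → f c = 0 := fun c hc hcb =>
    hf0 c (Or.inr (Finset.mem_erase.2 ⟨hcb, hc⟩))
  have hval : ∀ {x e : E} {a : E → ℝ}, e ∈ genCone X → x + e = ∑ c ∈ J, a c • c →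
      (f b)⁻¹ * f x = a b := by
    intro x e a he hxe
    have h := congrArg f hxe
    rw [map_add, hfe e he, add_zero, map_sum, ← Finset.add_sum_erase J _ hb,
      Finset.sum_eq_zero fun c hc => by
        rw [map_smul, hfJ c (Finset.mem_of_mem_erase hc) (Finset.ne_of_mem_erase hc), smul_zero],
      add_zero, map_smul, smul_eq_mul] at h
    rw [h]
    field_simp
  refine ⟨(f b)⁻¹ • f, ?_, ?_, ?_, ?_, ?_⟩
  · simp [hfb]
  · intro x hx
    simp [hfX x hx]
  · intro c hc hcb
    simp [hfJ c hc hcb]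
  · intro v hv
    obtain ⟨e, he, a, ha, hea⟩ := hQ v (mem_genCone_of_mem hv)
    rw [LinearMap.smul_apply, smul_eq_mul, hval he hea]
    exact ha b hb
  · intro v hv hfv
    obtain ⟨e, he, a, ha, hea⟩ := hQ v (mem_genCone_of_mem hv)
    rw [LinearMap.smul_apply, smul_eq_mul, hval he hea] at hfv
    have hins : insert v X ⊆ V := Finset.insert_subset hv hXV
    exact hface (faceOf_add (mem_faceOf_of_mem hins (Finset.mem_insert_self v X))
      (faceOf_mono (Finset.subset_insert v X) hins (genCone_subset_faceOf hXV he))) ha hea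
      ((ha b hb).lt_of_ne' hfv)

/-- Functionals on the cone over a lattice polytope of degree `d`, with values between `0` and `1`
on the generators, at most one of which is nonzero at each generator. -/
theorem exists_dual_family [FiniteDimensional ℝ E] {V : Finset E}
    (hV : Submodule.span ℝ (V : Set E) = ⊤) {n d : ℕ} (hn : Module.finrank ℝ E = n + 1)
    (hcodeg : ∀ S ⊆ V, IsConeInterior V (∑ v ∈ S, v) → n + 1 ≤ S.card + d) :
    ∃ (I : Finset E) (u : E → E →ₗ[ℝ] ℝ) (t : E → E) (Y : Finset E),
      n + 1 ≤ I.card + 5 * d ∧ Y ⊆ V ∧ (∀ b ∈ I, t b ∈ V) ∧ (∀ b ∈ I, u b (t b) = 1) ∧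
      (∀ b ∈ I, ∀ v ∈ V, 0 ≤ u b v ∧ u b v ≤ 1) ∧
      (∀ v ∈ V, ∀ b ∈ I, ∀ c ∈ I, u b v ≠ 0 → u c v ≠ 0 → b = c) ∧
      (∀ b ∈ I, ∀ y ∈ Y, u b y = 0) ∧
      Submodule.span ℝ (I.image t ∪ Y : Set E) = ⊤ := by
  obtain ⟨J, hJV, hJ, hP⟩ := exists_minimal_interior hV
  obtain ⟨B, hBV, hBc, hJB, hQ⟩ := exists_complement hV hJV hJ hP
  obtain ⟨X, hBX, hXV, hXc, hX⟩ := exists_saturated hJV hBV hJ hcodeg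
  have hJc := hcodeg J hJV hJ
  set I := J.filter fun b => b ∉ faceOf V X with hI
  have hIJ : I ⊆ J := Finset.filter_subset _ _
  have hdual : ∀ b ∈ I, ∃ f : E →ₗ[ℝ] ℝ, f b = 1 ∧ (∀ x ∈ X, f x = 0) ∧
      (∀ c ∈ J, c ≠ b → f c = 0) ∧ (∀ v ∈ V, 0 ≤ f v) ∧
      ∀ v ∈ V, f v ≠ 0 → b ∈ faceOf V (insert v X) := fun b hb => by
    refine exists_dual_functional hXV hJV hP (fun x hx => ?_) (hIJ hb) (Finset.mem_filter.1 hb).2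
    obtain ⟨e, he, h⟩ := hQ x hx
    exact ⟨e, genCone_mono hBX he, h⟩
  choose! f hfb hfX hfJ hf0 hfV using hdual
  have hmax : ∀ b ∈ I, ∃ t ∈ V, ∀ v ∈ V, f b v ≤ f b t := fun b hb =>
    V.exists_max_image (f b) ⟨b, hJV (hIJ hb)⟩
  choose! t htV htmax using hmax
  have htpos : ∀ b ∈ I, 0 < f b (t b) := fun b hb =>
    one_pos.trans_le ((hfb b hb).ge.trans (htmax b hb b (hJV (hIJ hb))))
  have huniq : ∀ v ∈ V, ∀ b ∈ I, ∀ c ∈ I, f b v ≠ 0 → f c v ≠ 0 → b = c := by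
    intro v hv b hb c hc hbv hcv
    by_contra hbc
    have hsub : insert b (insert c (J.filter fun b => b ∈ faceOf V X)) ⊆
        J.filter fun b => b ∈ faceOf V (insert v X) := by
      intro w hw
      simp only [Finset.mem_insert, Finset.mem_filter] at hw ⊢
      rcases hw with rfl | rfl | ⟨hw, hwX⟩
      · exact ⟨hIJ hb, hfV w hb v hv hbv⟩
      · exact ⟨hIJ hc, hfV w hc v hv hcv⟩
      · exact ⟨hw, faceOf_mono (Finset.subset_insert v X) (Finset.insert_subset hv hXV) hwX⟩
    have hcard := Finset.card_le_card hsub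
    rw [Finset.card_insert_of_notMem, Finset.card_insert_of_notMem] at hcard
    · have := hX v hv
      rw [faceCount, faceCount] at this
      omega
    · exact fun h => (Finset.mem_filter.1 hc).2 (Finset.mem_filter.1 h).2
    · rw [Finset.mem_insert, not_or]
      exact ⟨hbc, fun h => (Finset.mem_filter.1 hb).2 (Finset.mem_filter.1 h).2⟩
  have hYV : X ∪ J \ I ⊆ V := Finset.union_subset hXV (Finset.sdiff_subset.trans hJV)
  have hfY : ∀ b ∈ I, ∀ y ∈ X ∪ J \ I, f b y = 0 := by
    intro b hb y hy
    rcases Finset.mem_union.1 hy with h | h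
    · exact hfX b hb y h
    · obtain ⟨h1, h2⟩ := Finset.mem_sdiff.1 h
      exact hfJ b hb y h1 fun h => h2 (h ▸ hb)
  refine ⟨I, fun b => (f b (t b))⁻¹ • f b, t, X ∪ J \ I, ?_, hYV, htV, ?_, ?_, ?_, ?_, ?_⟩
  · have hc := Finset.card_filter_add_card_filter_not (s := J) fun b => b ∈ faceOf V X
    rw [← hI] at hc
    rw [faceCount] at hXc
    omega
  · intro b hb
    simp [(htpos b hb).ne']
  · intro b hb v hv
    have h := htpos b hb
    simp only [LinearMap.smul_apply, smul_eq_mul]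
    refine ⟨mul_nonneg (inv_nonneg.2 h.le) (hf0 b hb v hv), ?_⟩
    rw [inv_mul_le_iff₀ h, mul_one]
    exact htmax b hb v hv
  · intro v hv b hb c hc hbv hcv
    refine huniq v hv b hb c hc (fun h => hbv ?_) fun h => hcv ?_ <;> simp [h]
  · intro b hb y hy
    simp [hfY b hb y hy]
  · have htt : ∀ b ∈ I, ∀ c ∈ I, c ≠ b → f b (t c) = 0 := fun b hb c hc hcb => by
      by_contra h
      exact hcb (huniq (t c) (htV c hc) c hc b hb (htpos c hc).ne' h)
    have hspanY : ∀ y ∈ X ∪ J \ I,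
        y ∈ Submodule.span ℝ (I.image t ∪ (X ∪ J \ I : Finset E) : Set E) :=
      fun y hy => Submodule.subset_span (Or.inr hy)
    have hle : Submodule.span ℝ (J ∪ B : Set E) ≤
        Submodule.span ℝ (I : Set E) ⊔ Submodule.span ℝ ((X ∪ J \ I : Finset E) : Set E) := by
      rw [← Submodule.span_union]
      refine Submodule.span_mono ?_
      rintro v (hv | hv)
      · by_cases hvI : v ∈ I
        · exact Or.inl hvI
        · exact Or.inr (by simp [hvI, Finset.mem_coe.1 hv])
      · exact Or.inr (by simp [hBX (Finset.mem_coe.1 hv)])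
    rw [hJB] at hle
    rw [eq_top_iff]
    intro x _
    have hmem : ∑ b ∈ I, ((f b (t b))⁻¹ * f b x) • t b ∈
        Submodule.span ℝ (I.image t ∪ (X ∪ J \ I : Finset E) : Set E) :=
      Submodule.sum_mem _ fun b hb => Submodule.smul_mem _ _
        (Submodule.subset_span (Or.inl (Finset.mem_coe.2 (Finset.mem_image_of_mem t hb))))
    obtain ⟨i, hi, y, hy, hiy⟩ := Submodule.mem_sup.1
      (hle (Submodule.mem_top (x := x - ∑ b ∈ I, ((f b (t b))⁻¹ * f b x) • t b)))
    obtain ⟨c, -, rfl⟩ := Submodule.mem_span_finset.1 hi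
    have hc : ∀ b ∈ I, c b = 0 := by
      intro b hb
      have h := congrArg (f b) hiy
      have hy0 : f b y = 0 := by
        have : Submodule.span ℝ ((X ∪ J \ I : Finset E) : Set E) ≤ LinearMap.ker (f b) :=
          Submodule.span_le.2 fun y hy => hfY b hb y hy
        exact this hy
      have h1 : f b (∑ c ∈ I, ((f c (t c))⁻¹ * f c x) • t c) = f b x := by
        rw [map_sum, Finset.sum_eq_single_of_mem b hb fun c hc hcb => by
          rw [map_smul, htt b hb c hc hcb, smul_zero]]
        rw [map_smul, smul_eq_mul]
        field_simp [(htpos b hb).ne']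
      rw [map_add, hy0, map_sub, h1, sub_self, add_zero, map_sum,
        Finset.sum_eq_single_of_mem b hb fun a ha hab => by
          rw [map_smul, hfJ b hb a (hIJ ha) hab, smul_zero], map_smul, hfb b hb, smul_eq_mul,
        mul_one] at h
      exact h
    rw [Finset.sum_eq_zero fun b hb => by rw [hc b hb, zero_smul], zero_add] at hiy
    rw [← sub_add_cancel x (∑ b ∈ I, ((f b (t b))⁻¹ * f b x) • t b), ← hiy]
    exact Submodule.add_mem _ (Submodule.span_mono Set.subset_union_right hy) hmem

end DualFunctionals

section IntegralFunctionals

open Classical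

variable {E : Type*} [NormedAddCommGroup E] [NormedSpace ℝ E]

/-- Lattice functionals exhibiting the cone over a lattice polytope of degree `d` as the cone over
a Cayley sum. -/
theorem exists_integral_family [FiniteDimensional ℝ E] {Λ : AddSubgroup E}
    (hfin : ∀ R : ℝ, {x : E | x ∈ Λ ∧ ‖x‖ ≤ R}.Finite) {ht : E →ₗ[ℝ] ℝ} {V : Finset E}
    (hVΛ : ∀ v ∈ V, v ∈ Λ) (hht : ∀ v ∈ V, ht v = 1) (hinteger : ∀ x ∈ Λ, ∃ k : ℤ, ht x = k)
    (hV : Submodule.span ℝ (V : Set E) = ⊤) {n d : ℕ} (hn : Module.finrank ℝ E = n + 1)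
    (hcodeg : ∀ x ∈ Λ, x ∈ genCone V → IsConeInterior V x → ∀ r : ℕ, ht x = r → n + 1 ≤ r + d) :
    ∃ s ≤ n, (n ≤ s ∨ n + 1 ≤ s + 9 * d) ∧ ∃ (u : Fin s → E →ₗ[ℝ] ℝ) (t : Fin s → E),
      (∀ i, t i ∈ V) ∧ (∃ v ∈ V, ∀ i, u i v = 0) ∧
      (∀ i j, u i (t j) = if i = j then 1 else 0) ∧
      (∀ i, ∀ x ∈ Λ, ∃ k : ℤ, u i x = k) ∧
      ∀ v ∈ V, (∀ i, u i v = 0) ∨ ∃ j, ∀ i, u i v = if i = j then 1 else 0 := by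
  obtain ⟨I, u, t, Y, hIc, hYV, htV, hut, hu1, huniq, huY, hspan⟩ :=
    exists_dual_family hV hn (d := d) fun S hS hSi =>
      hcodeg _ (Λ.sum_mem fun v hv => hVΛ v (hS hv))
        (genCone_sum _ _ fun v hv => mem_genCone_of_mem (hS hv)) hSi S.card
        (by rw [map_sum, Finset.sum_congr rfl fun v hv => hht v (hS hv)]; simp)
  have hδ : ∀ b ∈ I, ∀ c ∈ I, u b (t c) = if b = c then 1 else 0 := by
    intro b hb c hc
    split_ifs with h
    · rw [← h, hut b hb]
    · by_contra h0
      exact h (huniq (t c) (htV c hc) b hb c hc h0 (by rw [hut c hc]; exact one_ne_zero))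
  have htinj : Set.InjOn t I := fun b hb c hc hbc => by
    by_contra h
    have h1 := hδ b hb c hc
    rw [← hbc, hut b hb, if_neg h] at h1
    exact one_ne_zero h1
  have hli : LinearIndepOn ℝ id (I.image t : Set E) := by
    rw [linearIndepOn_finset_iff]
    intro a ha b hb
    obtain ⟨c, hc, rfl⟩ := Finset.mem_image.1 hb
    have h := congrArg (u c) ha
    rw [Finset.sum_image htinj, map_sum, map_zero, Finset.sum_eq_single_of_mem c hc] at h
    · simpa [hut c hc] using h
    · intro b hb hbc
      simp [hδ c hc b hb, hbc.symm]
  obtain ⟨σ, htσ, hσ, hσb⟩ := exists_isBasisSet_between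
    (Finset.subset_union_left (s₁ := I.image t) (s₂ := Y)) hli (by simpa using hspan)
  have hσV : σ ⊆ V := hσ.trans (Finset.union_subset
    (fun v hv => by obtain ⟨b, hb, rfl⟩ := Finset.mem_image.1 hv; exact htV b hb) hYV)
  have huσ : ∀ b ∈ I, ∀ c ∈ σ, c ≠ t b → u b c = 0 := by
    intro b hb c hc hcb
    rcases Finset.mem_union.1 (hσ hc) with h | h
    · obtain ⟨c, hcI, rfl⟩ := Finset.mem_image.1 h
      rw [hδ b hb c hcI, if_neg]
      rintro rfl
      exact hcb rfl
    · exact huY b hb c h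
  have hcoord : ∀ b ∈ I, basisCoord σ (t b) = u b := by
    intro b hb
    have hbσ : t b ∈ σ := htσ (Finset.mem_image_of_mem t hb)
    ext x
    rw [hσb.apply_eq (u b) x, Finset.sum_eq_single_of_mem (t b) hbσ fun c hc hcb => by
      rw [huσ b hb c hc hcb, mul_zero], hut b hb, mul_one]
  set I' := I.filter fun b => ∀ x ∈ Λ, ∃ k : ℤ, u b x = k with hI'
  have hI'I : I' ⊆ I := Finset.filter_subset _ _
  have hcard : n + 1 ≤ I'.card + 9 * d := by
    have h1 : (I.filter fun b => ¬ ∀ x ∈ Λ, ∃ k : ℤ, u b x = k).card ≤ 4 * d := by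
      refine le_trans ?_ (card_nonintegral_le hfin hVΛ hht hinteger hn hcodeg hσb hσV)
      refine Finset.card_le_card_of_injOn t (fun b hb => ?_)
        (htinj.mono (Finset.coe_subset.2 (Finset.filter_subset _ _)))
      obtain ⟨hb, hb'⟩ := Finset.mem_filter.1 hb
      refine Finset.mem_filter.2 ⟨htσ (Finset.mem_image_of_mem t hb), ?_⟩
      rwa [hcoord b hb]
    have h2 := Finset.card_filter_add_card_filter_not (s := I)
      fun b => ∀ x ∈ Λ, ∃ k : ℤ, u b x = k
    rw [← hI'] at h2
    omega
  have hI'σ : I'.image t ⊆ σ := (Finset.image_subset_image hI'I).trans htσ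
  have hI'c : (I'.image t).card = I'.card :=
    Finset.card_image_of_injOn (htinj.mono (Finset.coe_subset.2 hI'I))
  have hσc : σ.card = n + 1 := by rw [hσb.card_eq, hn]
  obtain ⟨K, hKI, hKn, hKc, v, hv, hv0⟩ : ∃ K ⊆ I', K.card ≤ n ∧
      (n ≤ K.card ∨ n + 1 ≤ K.card + 9 * d) ∧ ∃ v ∈ V, ∀ b ∈ K, u b v = 0 := by
    by_cases hle : I'.card ≤ n
    · obtain ⟨v, hv, hvI⟩ := Finset.exists_mem_notMem_of_card_lt_card
        (s := I'.image t) (t := σ) (by omega)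
      refine ⟨I', Finset.Subset.refl _, hle, Or.inr hcard, v, hσV hv, fun b hb => ?_⟩
      refine huσ b (hI'I hb) v hv ?_
      rintro rfl
      exact hvI (Finset.mem_image_of_mem t hb)
    · have h1 := Finset.card_le_card hI'σ
      obtain ⟨b, hb⟩ := Finset.card_pos.1 (show 0 < I'.card by omega)
      have h2 := Finset.card_erase_of_mem hb
      refine ⟨I'.erase b, Finset.erase_subset _ _, by omega, Or.inl (by omega), t b,
        htV b (hI'I hb), fun c hc => ?_⟩
      rw [hδ c (hI'I (Finset.mem_of_mem_erase hc)) b (hI'I hb),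
        if_neg (Finset.ne_of_mem_erase hc)]
  let e := K.equivFin.symm
  have hK : ∀ i, (e i : E) ∈ I := fun i => hI'I (hKI (e i).2)
  have he : ∀ i j, (e i : E) = e j ↔ i = j := fun i j => by
    rw [Subtype.coe_inj, e.injective.eq_iff]
  refine ⟨K.card, hKn, hKc, fun i => u (e i), fun i => t (e i), fun i => htV _ (hK i),
    ⟨v, hv, fun i => hv0 _ (e i).2⟩, fun i j => ?_,
    fun i => (Finset.mem_filter.1 (hKI (e i).2)).2, fun w hw => ?_⟩
  · simp only [hδ _ (hK i) _ (hK j), he]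
  · by_cases hall : ∀ i, u (e i) w = 0
    · exact Or.inl hall
    push Not at hall
    obtain ⟨j, hj⟩ := hall
    refine Or.inr ⟨j, fun i => ?_⟩
    split_ifs with hij
    · subst hij
      obtain ⟨k, hk⟩ := (Finset.mem_filter.1 (hKI (e i).2)).2 w (hVΛ w hw)
      have h01 := hu1 _ (hK i) w hw
      rw [hk] at h01 hj ⊢
      have h0 : (0 : ℤ) ≤ k := by exact_mod_cast h01.1
      have h1 : k ≤ (1 : ℤ) := by exact_mod_cast h01.2
      have h2 : k ≠ 0 := by exact_mod_cast hj
      have h3 : k = 1 := by omega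
      simp [h3]
    · by_contra h0
      exact hij ((he i j).1 (huniq w hw _ (hK i) _ (hK j) h0 hj))

end IntegralFunctionals

section LatticeSplitting

/-- A surjection of free abelian groups of finite rank is a coordinate projection in suitable
coordinates. -/
theorem exists_int_equiv_prod {n s : ℕ} (G : (Fin n → ℤ) →ₗ[ℤ] (Fin s → ℤ))
    (hG : Function.Surjective G) :
    ∃ q, q + s = n ∧ ∃ A : (Fin n → ℤ) ≃ₗ[ℤ] (Fin q → ℤ) × (Fin s → ℤ), ∀ z, (A z).2 = G z := by
  obtain ⟨r, hr⟩ := Module.projective_lifting_property G LinearMap.id hG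
  have hr : ∀ w, G (r w) = w := fun w => LinearMap.congr_fun hr w
  let p : (Fin n → ℤ) →ₗ[ℤ] LinearMap.ker G :=
    (LinearMap.id - r ∘ₗ G).codRestrict (LinearMap.ker G) fun z => by simp [hr]
  have hp : ∀ z, (p z : Fin n → ℤ) = z - r (G z) := fun z => rfl
  have hbij : Function.Bijective (p.prod G) := by
    constructor
    · rw [← LinearMap.ker_eq_bot, LinearMap.ker_eq_bot']
      intro z hz
      obtain ⟨h1, h2⟩ := Prod.mk.inj hz
      have h := congrArg Subtype.val h1
      rw [hp, show G z = 0 from h2, map_zero, sub_zero] at h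
      exact h
    · rintro ⟨k, w⟩
      have hk : G (k : Fin n → ℤ) = 0 := k.2
      have hG' : G ((k : Fin n → ℤ) + r w) = w := by rw [map_add, hk, hr, zero_add]
      refine ⟨k + r w, Prod.ext (Subtype.ext ?_) hG'⟩
      change (p (k + r w) : Fin n → ℤ) = k
      rw [hp, hG', add_sub_cancel_right]
  let A := (LinearEquiv.ofBijective (p.prod G) hbij).trans
    ((Module.finBasis ℤ (LinearMap.ker G)).equivFun.prodCongr (LinearEquiv.refl ℤ (Fin s → ℤ)))
  refine ⟨Module.finrank ℤ (LinearMap.ker G), ?_, A, fun z => rfl⟩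
  have := A.finrank_eq
  simpa using this.symm

theorem IsLatticePoint.exists_eq_cast {m : ℕ} {v : Fin m → ℝ} (h : IsLatticePoint v) :
    ∃ z : Fin m → ℤ, v = fun i => (z i : ℝ) := by
  choose z hz using h
  exact ⟨z, funext hz⟩

theorem isLatticePoint_cast {m : ℕ} (z : Fin m → ℤ) : IsLatticePoint fun i => (z i : ℝ) :=
  fun i => ⟨z i, rfl⟩

/-- The real linear map which extends a `ℤ`-linear map. -/
def realExtension {m k : Type*} [Fintype m] [DecidableEq m] (A : (m → ℤ) →ₗ[ℤ] (k → ℤ)) :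
    (m → ℝ) →ₗ[ℝ] (k → ℝ) :=
  Matrix.mulVecLin ((LinearMap.toMatrix' A).map (Int.castRingHom ℝ))

theorem realExtension_cast {m k : Type*} [Fintype m] [DecidableEq m]
    (A : (m → ℤ) →ₗ[ℤ] (k → ℤ)) (z : m → ℤ) :
    realExtension A (fun i => (z i : ℝ)) = fun i => (A z i : ℝ) := by
  funext i
  have h := congrFun (LinearMap.toMatrix'_mulVec A z) i
  rw [← h, realExtension, Matrix.mulVecLin_apply]
  simp [Matrix.mulVec, dotProduct]

theorem linearMap_ext_cast {m : Type*} [Finite m] {F : Type*} [AddCommGroup F]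
    [Module ℝ F] {f g : (m → ℝ) →ₗ[ℝ] F}
    (h : ∀ z : m → ℤ, f (fun i => (z i : ℝ)) = g fun i => (z i : ℝ)) : f = g := by
  classical
  refine (Pi.basisFun ℝ m).ext fun k => ?_
  have hk := h (Pi.single k 1)
  have : (fun i => ((Pi.single k 1 : m → ℤ) i : ℝ)) = Pi.basisFun ℝ m k := by
    funext i
    simp [Pi.single_apply]
  rwa [this] at hk

/-- Linear functionals which are integral on `ℤ^n` and form a surjection onto `ℤ^s` are coordinate
functions of a unimodular linear change of coordinates. -/
theorem exists_unimodular_equiv {n s : ℕ} (g : Fin s → (Fin n → ℝ) →ₗ[ℝ] ℝ)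
    (hg : ∀ i v, IsLatticePoint v → ∃ k : ℤ, g i v = k) (w : Fin s → Fin n → ℝ)
    (hw : ∀ j, IsLatticePoint (w j)) (hgw : ∀ i j, g i (w j) = if i = j then 1 else 0) :
    ∃ q, q + s = n ∧ ∃ M : (Fin n → ℝ) ≃ₗ[ℝ] (Fin q → ℝ) × (Fin s → ℝ),
      (∀ v i, (M v).2 i = g i v) ∧ ∀ v, IsLatticePoint v ↔ IsLatticePointPair (M v) := by
  choose c hc using fun (i : Fin s) (z : Fin n → ℤ) => hg i _ (isLatticePoint_cast z)
  let G : (Fin n → ℤ) →ₗ[ℤ] (Fin s → ℤ) :=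
    (AddMonoidHom.mk' (fun z i => c i z) fun a b => by
      funext i
      have : (c i (a + b) : ℝ) = c i a + c i b := by
        rw [← hc, ← hc, ← hc, ← map_add]
        congr 1
        funext k
        simp
      exact_mod_cast this).toIntLinearMap
  have hG : ∀ z i, G z i = c i z := fun z i => rfl
  choose w' hw' using fun j => (hw j).exists_eq_cast
  have hGw : ∀ j, G (w' j) = Pi.single j 1 := fun j => by
    funext i
    have h := hgw i j
    rw [hw', hc] at h
    rw [hG, Pi.single_apply]
    split_ifs at h ⊢ <;> exact_mod_cast h
  have hsurj : Function.Surjective G := fun y => by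
    refine ⟨∑ j, y j • w' j, ?_⟩
    rw [map_sum]
    simp only [map_smul, hGw]
    funext i
    simp [Finset.sum_apply, Pi.single_apply]
  obtain ⟨q, hq, A, hA⟩ := exists_int_equiv_prod G hsurj
  let B : (Fin n → ℤ) ≃ₗ[ℤ] (Fin q ⊕ Fin s → ℤ) :=
    A.trans (LinearEquiv.sumArrowLequivProdArrow (Fin q) (Fin s) ℤ ℤ).symm
  let L : (Fin n → ℝ) ≃ₗ[ℝ] (Fin q ⊕ Fin s → ℝ) :=
    LinearEquiv.ofLinearMap (realExtension B.toLinearMap) (realExtension B.symm.toLinearMap)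
      (linearMap_ext_cast fun z => by simp [realExtension_cast])
      (linearMap_ext_cast fun z => by simp [realExtension_cast])
  let M := L.trans (LinearEquiv.sumArrowLequivProdArrow (Fin q) (Fin s) ℝ ℝ)
  have hM : ∀ z : Fin n → ℤ, M (fun i => (z i : ℝ)) =
      ((fun i => ((A z).1 i : ℝ)), fun i => ((A z).2 i : ℝ)) := fun z => by
    have h : L (fun i => (z i : ℝ)) = fun i => (B z i : ℝ) := realExtension_cast _ z
    change (LinearEquiv.sumArrowLequivProdArrow (Fin q) (Fin s) ℝ ℝ) (L fun i => (z i : ℝ)) = _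
    rw [h]
    rfl
  refine ⟨q, hq, M, fun v i => ?_, fun v => ⟨fun hv => ?_, fun hv => ?_⟩⟩
  · have : (LinearMap.proj i ∘ₗ LinearMap.snd ℝ _ _) ∘ₗ M.toLinearMap = g i :=
      linearMap_ext_cast fun z => by
        rw [hc, ← hG, ← hA]
        change (M fun i => (z i : ℝ)).2 i = _
        rw [hM]
    exact LinearMap.congr_fun this v
  · obtain ⟨z, rfl⟩ := hv.exists_eq_cast
    rw [hM]
    exact ⟨isLatticePoint_cast _, isLatticePoint_cast _⟩
  · obtain ⟨a, ha⟩ := hv.1.exists_eq_cast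
    obtain ⟨b, hb⟩ := hv.2.exists_eq_cast
    have h : v = fun i => (A.symm (a, b) i : ℝ) := by
      refine M.injective ?_
      rw [hM, A.apply_symm_apply]
      exact Prod.ext ha hb
    rw [h]
    exact isLatticePoint_cast _

end LatticeSplitting

section CayleyAssembly

theorem cayleyVertex_zero (s : ℕ) : cayleyVertex s 0 = 0 := by
  funext i
  simp [cayleyVertex]

theorem cayleyVertex_succ {s : ℕ} (j i : Fin s) :
    cayleyVertex s j.succ i = if i = j then 1 else 0 := by
  simp [cayleyVertex, Fin.ext_iff]

/-- A polytope all of whose vertices lie over the vertices of the unit simplex is a Cayley sum. -/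
theorem convexHull_eq_cayleySum {q s : ℕ} (W : Set ((Fin q → ℝ) × (Fin s → ℝ)))
    (hW : ∀ w ∈ W, ∃ j, w.2 = cayleyVertex s j) :
    convexHull ℝ W =
      CayleySum fun j => convexHull ℝ {p : Fin q → ℝ | (p, cayleyVertex s j) ∈ W} := by
  refine Set.Subset.antisymm (convexHull_mono fun w hw => ?_)
    (convexHull_min (Set.iUnion_subset fun j => ?_) (convex_convexHull ℝ W))
  · obtain ⟨j, hj⟩ := hW w hw
    refine Set.mem_iUnion.2 ⟨j, w.1, subset_convexHull ℝ _ ?_, by rw [← hj]⟩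
    rw [Set.mem_ofPred_eq, ← hj]
    exact hw
  · have h := (AffineMap.prod (AffineMap.id ℝ (Fin q → ℝ))
      (AffineMap.const ℝ (Fin q → ℝ) (cayleyVertex s j))).image_convexHull
        {p : Fin q → ℝ | (p, cayleyVertex s j) ∈ W}
    have hcoe : ⇑(AffineMap.prod (AffineMap.id ℝ (Fin q → ℝ))
      (AffineMap.const ℝ (Fin q → ℝ) (cayleyVertex s j))) = fun p => (p, cayleyVertex s j) := rfl
    rw [hcoe] at h
    rw [h]
    refine convexHull_mono ?_
    rintro _ ⟨p, hp, rfl⟩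
    exact hp

/-- Affine functionals which are integral on `ℤ^n` and map the vertices of `P` onto the vertices
of the unit simplex give rise to a Cayley decomposition of `P`. -/
theorem exists_cayley_decomposition {n s : ℕ} {V : Finset (Fin n → ℝ)}
    (hV : ∀ v ∈ V, IsLatticePoint v) (g : Fin s → (Fin n → ℝ) →ₗ[ℝ] ℝ) (β : Fin s → ℤ)
    (hg : ∀ i v, IsLatticePoint v → ∃ k : ℤ, g i v = k) (t : Fin s → Fin n → ℝ)
    (ht : ∀ j, t j ∈ V) (hgt : ∀ i j, g i (t j) + β i = if i = j then 1 else 0)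
    (h0 : ∃ v ∈ V, ∀ i, g i v + β i = 0)
    (hcases : ∀ v ∈ V, (∀ i, g i v + β i = 0) ∨ ∃ j, ∀ i, g i v + β i = if i = j then 1 else 0) :
    ∃ q, q + s = n ∧ ∃ (Ps : Fin (s + 1) → Set (Fin q → ℝ))
        (T : (Fin n → ℝ) ≃ᵃ[ℝ] (Fin q → ℝ) × (Fin s → ℝ)),
        (∀ j, IsLatticePolytope (Ps j)) ∧ IsLatticeEquiv T ∧
          T '' convexHull ℝ (V : Set (Fin n → ℝ)) = CayleySum Ps := by
  classical
  obtain ⟨v₀, hv₀, hgv₀⟩ := h0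
  obtain ⟨q, hq, M, hM, hML⟩ := exists_unimodular_equiv g hg (fun j => t j - v₀)
    (fun j i => by
      obtain ⟨a, ha⟩ := hV _ (ht j) i
      obtain ⟨b, hb⟩ := hV _ hv₀ i
      exact ⟨a - b, by simp [ha, hb]⟩)
    (fun i j => by
      rw [map_sub, ← hgt i j]
      linarith [hgv₀ i])
  let T : (Fin n → ℝ) ≃ᵃ[ℝ] (Fin q → ℝ) × (Fin s → ℝ) :=
    M.toAffineEquiv.trans (AffineEquiv.constVAdd ℝ _ (0, fun i => (β i : ℝ)))
  have hT1 : ∀ v, (T v).1 = (M v).1 := fun v => zero_add _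
  have hT2 : ∀ v i, (T v).2 i = g i v + β i := fun v i => by
    rw [← hM v i]
    exact add_comm _ _
  have hTL : IsLatticeEquiv T := by
    intro v
    rw [hML v, IsLatticePointPair, IsLatticePointPair, hT1]
    refine and_congr Iff.rfl (forall_congr' fun i => ?_)
    rw [hT2, ← hM]
    constructor
    · rintro ⟨k, hk⟩
      exact ⟨k + β i, by rw [hk]; push_cast; ring⟩
    · rintro ⟨k, hk⟩
      exact ⟨k - β i, by push_cast; linarith⟩
  have hW : ∀ w ∈ T '' (V : Set (Fin n → ℝ)), ∃ j, w.2 = cayleyVertex s j := by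
    rintro _ ⟨v, hv, rfl⟩
    rcases hcases v hv with h | ⟨j, h⟩
    · exact ⟨0, by rw [cayleyVertex_zero]; funext i; rw [hT2, h]; rfl⟩
    · exact ⟨j.succ, by funext i; rw [hT2, h, cayleyVertex_succ]⟩
  refine ⟨q, hq, fun j => convexHull ℝ {p | (p, cayleyVertex s j) ∈ T '' (V : Set (Fin n → ℝ))},
    T, fun j => ?_, hTL, ?_⟩
  · have hfin : {p : Fin q → ℝ | (p, cayleyVertex s j) ∈ T '' (V : Set (Fin n → ℝ))}.Finite := by
      refine (V.finite_toSet.image fun v => (T v).1).subset ?_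
      rintro p ⟨v, hv, hvp⟩
      exact ⟨v, hv, by simp [hvp]⟩
    refine ⟨hfin.toFinset, ?_, ?_, by rw [hfin.coe_toFinset]⟩
    · rw [Set.Finite.toFinset_nonempty]
      rcases Fin.eq_zero_or_eq_succ j with rfl | ⟨i, rfl⟩
      · refine ⟨(T v₀).1, v₀, hv₀, Prod.ext rfl ?_⟩
        funext i
        rw [hT2, hgv₀, cayleyVertex_zero]
        rfl
      · refine ⟨(T (t i)).1, t i, ht i, Prod.ext rfl ?_⟩
        funext k
        rw [hT2, hgt]
        exact (cayleyVertex_succ i k).symm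
    · intro p hp
      obtain ⟨v, hv, hvp⟩ := hfin.mem_toFinset.1 hp
      have := ((hTL v).1 (hV v hv)).1
      rwa [hvp] at this
  · rw [← convexHull_eq_cayleySum _ hW]
    exact T.toAffineMap.image_convexHull _

end CayleyAssembly

section ConeOverPolytope

open Classical

/-- The lattice `ℤ^n × ℤ` in `ℝ^n × ℝ`. -/
def pairLattice (n : ℕ) : AddSubgroup ((Fin n → ℝ) × ℝ) where
  carrier := {x | IsLatticePoint x.1 ∧ ∃ k : ℤ, x.2 = k}
  zero_mem' := ⟨fun _ => ⟨0, by simp⟩, 0, by simp⟩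
  add_mem' := by
    rintro x y ⟨hx, k, hk⟩ ⟨hy, l, hl⟩
    refine ⟨fun i => ?_, k + l, by simp [hk, hl]⟩
    obtain ⟨a, ha⟩ := hx i
    obtain ⟨b, hb⟩ := hy i
    exact ⟨a + b, by simp [ha, hb]⟩
  neg_mem' := by
    rintro x ⟨hx, k, hk⟩
    refine ⟨fun i => ?_, -k, by simp [hk]⟩
    obtain ⟨a, ha⟩ := hx i
    exact ⟨-a, by simp [ha]⟩

theorem pairLattice_finite (n : ℕ) (R : ℝ) : {x | x ∈ pairLattice n ∧ ‖x‖ ≤ R}.Finite := by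
  have hbox : (Set.Icc (fun _ : Fin n => -⌈R⌉) (fun _ => ⌈R⌉) ×ˢ Set.Icc (-⌈R⌉) ⌈R⌉).Finite :=
    (Set.finite_Icc _ _).prod (Set.finite_Icc _ _)
  have hinteger : ∀ k : ℤ, |(k : ℝ)| ≤ R → -⌈R⌉ ≤ k ∧ k ≤ ⌈R⌉ := by
    intro k hk
    have h := abs_le.1 (hk.trans (Int.le_ceil R))
    exact ⟨by exact_mod_cast h.1, by exact_mod_cast h.2⟩
  refine (hbox.image fun z : (Fin n → ℤ) × ℤ =>
    (((fun i => (z.1 i : ℝ)), (z.2 : ℝ)) : (Fin n → ℝ) × ℝ)).subset ?_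
  rintro ⟨x, r⟩ ⟨⟨hx, k, hk⟩, hR⟩
  obtain ⟨z, rfl⟩ := IsLatticePoint.exists_eq_cast hx
  dsimp only at hk
  subst hk
  rw [Prod.norm_mk, max_le_iff] at hR
  have hz : ∀ i, |(z i : ℝ)| ≤ R := fun i =>
    (norm_le_pi_norm (fun i => (z i : ℝ)) i).trans hR.1
  exact ⟨(z, k), ⟨⟨fun i => (hinteger _ (hz i)).1, fun i => (hinteger _ (hz i)).2⟩,
    hinteger k hR.2⟩, rfl⟩

/-- The points of `V` placed at height one. -/
def liftOne {n : ℕ} (V : Finset (Fin n → ℝ)) : Finset ((Fin n → ℝ) × ℝ) :=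
  V.image fun v => (v, 1)

theorem mem_liftOne {n : ℕ} {V : Finset (Fin n → ℝ)} {x : (Fin n → ℝ) × ℝ} :
    x ∈ liftOne V ↔ ∃ v ∈ V, (v, 1) = x := Finset.mem_image

theorem mem_genCone_liftOne {n : ℕ} {V : Finset (Fin n → ℝ)} {x : Fin n → ℝ} {r : ℝ} :
    (x, r) ∈ genCone (liftOne V) ↔
      ∃ c : (Fin n → ℝ) → ℝ, (∀ v ∈ V, 0 ≤ c v) ∧ ∑ v ∈ V, c v • v = x ∧ ∑ v ∈ V, c v = r := by
  have hsum : ∀ c : (Fin n → ℝ) × ℝ → ℝ, ∑ v ∈ liftOne V, c v • v =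
      (∑ v ∈ V, c (v, 1) • v, ∑ v ∈ V, c (v, 1)) := by
    intro c
    rw [liftOne, Finset.sum_image fun v _ w _ h => (Prod.mk.inj h).1]
    simp [Prod.ext_iff, Prod.fst_sum, Prod.snd_sum]
  constructor
  · rintro ⟨c, hc, h⟩
    rw [hsum] at h
    obtain ⟨h1, h2⟩ := Prod.mk.inj h
    exact ⟨fun v => c (v, 1), fun v hv => hc _ (mem_liftOne.2 ⟨v, hv, rfl⟩), h1, h2⟩
  · rintro ⟨c, hc, h1, h2⟩
    refine ⟨fun v => c v.1, fun v hv => ?_, ?_⟩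
    · obtain ⟨w, hw, rfl⟩ := mem_liftOne.1 hv
      exact hc w hw
    · rw [hsum, ← h1, ← h2]

theorem mem_genCone_liftOne_nat {n : ℕ} {V : Finset (Fin n → ℝ)} (hV : V.Nonempty)
    {x : Fin n → ℝ} {m : ℕ} :
    (x, (m : ℝ)) ∈ genCone (liftOne V) ↔ x ∈ (m : ℝ) • convexHull ℝ (V : Set (Fin n → ℝ)) := by
  rw [mem_genCone_liftOne]
  constructor
  · rintro ⟨c, hc, rfl, hcm⟩
    rcases Nat.eq_zero_or_pos m with rfl | hm
    · rw [Nat.cast_zero] at hcm ⊢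
      rw [Finset.sum_eq_zero_iff_of_nonneg hc] at hcm
      rw [Set.zero_smul_set (convexHull_nonempty_iff.2 (Finset.coe_nonempty.2 hV)), Set.mem_zero]
      exact Finset.sum_eq_zero fun v hv => by rw [hcm v hv, zero_smul]
    · have hm' : (0 : ℝ) < m := by exact_mod_cast hm
      rw [Set.mem_smul_set_iff_inv_smul_mem₀ hm'.ne', Finset.mem_convexHull']
      refine ⟨fun v => (m : ℝ)⁻¹ * c v, fun v hv => mul_nonneg (by positivity) (hc v hv), ?_, ?_⟩
      · rw [← Finset.mul_sum, hcm, inv_mul_cancel₀ hm'.ne']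
      · simp only [mul_smul, Finset.smul_sum]
  · rintro ⟨y, hy, rfl⟩
    obtain ⟨w, hw, hw1, rfl⟩ := Finset.mem_convexHull'.1 hy
    refine ⟨fun v => m * w v, fun v hv => mul_nonneg (by positivity) (hw v hv), ?_, ?_⟩
    · simp only [mul_smul, Finset.smul_sum]
    · rw [← Finset.mul_sum, hw1, mul_one]

theorem latticePointCount_smul {n : ℕ} {V : Finset (Fin n → ℝ)} (hV : V.Nonempty) (m : ℕ) :
    latticePointCount ((m : ℝ) • convexHull ℝ (V : Set (Fin n → ℝ))) =
      Set.ncard {x | x ∈ pairLattice n ∧ LinearMap.snd ℝ (Fin n → ℝ) ℝ x = m ∧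
        x ∈ genCone (liftOne V)} := by
  rw [latticePointCount]
  refine Set.ncard_congr (fun z _ => ((fun i => (z i : ℝ)), (m : ℝ))) ?_ ?_ ?_
  · intro z hz
    exact ⟨⟨isLatticePoint_cast z, m, by simp⟩, rfl, (mem_genCone_liftOne_nat hV).2 hz⟩
  · intro z z' _ _ h
    funext i
    have := congrFun (Prod.mk.inj h).1 i
    exact_mod_cast this
  · rintro ⟨x, r⟩ ⟨⟨hx, -⟩, hr, hxC⟩
    obtain ⟨z, rfl⟩ := IsLatticePoint.exists_eq_cast hx
    have hr : r = m := hr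
    subst hr
    exact ⟨z, (mem_genCone_liftOne_nat hV).1 hxC, rfl⟩

theorem span_liftOne {n : ℕ} {V : Finset (Fin n → ℝ)}
    (hV : affineSpan ℝ (V : Set (Fin n → ℝ)) = ⊤) :
    Submodule.span ℝ (liftOne V : Set ((Fin n → ℝ) × ℝ)) = ⊤ := by
  have h1 : ∀ x : Fin n → ℝ,
      ((x, 1) : (Fin n → ℝ) × ℝ) ∈ Submodule.span ℝ (liftOne V : Set ((Fin n → ℝ) × ℝ)) := by
    intro x
    have hx : x ∈ affineSpan ℝ (V : Set (Fin n → ℝ)) := hV ▸ AffineSubspace.mem_top ℝ _ x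
    refine affineSpan_induction hx (fun v hv => Submodule.subset_span
      (Finset.mem_coe.2 (mem_liftOne.2 ⟨v, hv, rfl⟩))) fun c u v w hu hv hw => ?_
    convert Submodule.add_mem _ (Submodule.smul_mem _ c (Submodule.sub_mem _ hu hv)) hw using 1
    simp
  rw [eq_top_iff]
  rintro ⟨x, r⟩ -
  convert Submodule.add_mem _ (h1 x) (Submodule.smul_mem _ (r - 1) (h1 0)) using 1
  simp

end ConeOverPolytope

theorem nine_mul_le_quadratic {q d : ℕ} (h : q + 1 ≤ 9 * d) : q ≤ (d ^ 2 + 19 * d - 4) / 2 := by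
  rw [Nat.le_div_iff_mul_le two_pos]
  obtain ⟨e, rfl⟩ : ∃ e, d = e + 1 := ⟨d - 1, by omega⟩
  have : (e + 1) ^ 2 = e ^ 2 + 2 * e + 1 := by ring
  have : e ≤ e ^ 2 := Nat.le_self_pow two_ne_zero e
  omega

/-- (Theorem 1.2 / `Cayley`.) Every `n`-dimensional lattice polytope `P`
of degree `d` decomposes as a Cayley sum of lattice polytopes `P_0, …, P_s` in `ℝ^q` for
some `q ≤ (d² + 19d − 4)/2` and `s` with `q + s = n`, under a `ℤ`-affine linear change of
coordinates `ℝ^n ≅ ℝ^q × ℝ^s`. -/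
theorem statement2 (n d : ℕ) (P : Set (Fin n → ℝ)) (h : Polynomial ℤ)
    (hP : IsLatticePolytope P) (hfull : affineSpan ℝ P = ⊤)
    (hh : IsHStarPoly P h) (hdeg : h.natDegree = d) :
    ∃ q s : ℕ, q + s = n ∧ q ≤ (d ^ 2 + 19 * d - 4) / 2 ∧
      ∃ (Ps : Fin (s + 1) → Set (Fin q → ℝ))
        (T : (Fin n → ℝ) ≃ᵃ[ℝ] (Fin q → ℝ) × (Fin s → ℝ)),
        (∀ j, IsLatticePolytope (Ps j)) ∧ IsLatticeEquiv T ∧ T '' P = CayleySum Ps := by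
  obtain ⟨V, hVne, hVlat, rfl⟩ := hP
  obtain ⟨hdn, -, hcount⟩ := hh
  rw [affineSpan_convexHull] at hfull
  have hVΛ : ∀ v ∈ liftOne V, v ∈ pairLattice n := by
    intro x hx
    obtain ⟨v, hv, rfl⟩ := mem_liftOne.1 hx
    exact ⟨hVlat v hv, 1, by simp⟩
  have hht : ∀ v ∈ liftOne V, LinearMap.snd ℝ (Fin n → ℝ) ℝ v = 1 := by
    intro x hx
    obtain ⟨v, hv, rfl⟩ := mem_liftOne.1 hx
    rfl
  have hn : Module.finrank ℝ ((Fin n → ℝ) × ℝ) = n + 1 := by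
    rw [Module.finrank_prod, Module.finrank_fin_fun, Module.finrank_self]
  have hspan := span_liftOne hfull
  obtain ⟨s, -, hs, u, t, htV, ⟨v₀, hv₀, huv₀⟩, hut, huΛ, hcases⟩ :=
    exists_integral_family (pairLattice_finite n) hVΛ hht (fun x hx => hx.2) hspan hn
      fun x hxΛ hxC hx r hr => codegree_le_height (pairLattice_finite n) hVΛ hht hspan hn
        (a := h.coeff) (d := d) (hdeg ▸ hdn)
        (fun i hi => Polynomial.coeff_eq_zero_of_natDegree_lt (hdeg ▸ hi))
        (fun m => by rw [← latticePointCount_smul hVne, hcount]) hxΛ hxC hx hr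
  choose β hβ using fun i => huΛ i (0, 1) ⟨fun _ => ⟨0, by simp⟩, 1, by simp⟩
  have hu : ∀ i v, u i (v, 1) = (u i ∘ₗ LinearMap.inl ℝ _ _) v + β i := fun i v => by
    rw [← hβ, LinearMap.comp_apply, LinearMap.inl_apply, ← map_add]
    simp
  choose t' ht' htt using fun j => mem_liftOne.1 (htV j)
  obtain ⟨w₀, hw₀, rfl⟩ := mem_liftOne.1 hv₀
  obtain ⟨q, hq, Ps, T, hPs⟩ := exists_cayley_decomposition hVlat
    (fun i => u i ∘ₗ LinearMap.inl ℝ _ _) β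
    (fun i v hv => huΛ i (v, 0) ⟨hv, 0, by simp⟩) t' ht'
    (fun i j => by rw [← hu, htt, hut]) ⟨w₀, hw₀, fun i => by rw [← hu, huv₀]⟩
    (fun v hv => by
      simp only [← hu]
      exact hcases _ (mem_liftOne.2 ⟨v, hv, rfl⟩))
  refine ⟨q, s, hq, ?_, Ps, T, hPs⟩
  rcases hs with hs | hs
  · have : q = 0 := by omega
    omega
  · exact nine_mul_le_quadratic (by omega)

end
end

section
/- In the setup below, for any point y in the cone σ spanned by P, there exists a point y' ∈ σ such that V^−(y') ⊇ V^−(y) and |V^+(y')| ≤ |Z|. -/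
open scoped BigOperators Pointwise

noncomputable section

open Filter Topology

/-- The lattice points of `ℝ^m`, as an additive subgroup. -/
def latticePoints (m : ℕ) : AddSubgroup (Fin m → ℝ) where
  carrier := {v | IsLatticePoint v}
  add_mem' := fun {a b} ha hb i => by
    obtain ⟨s, hs⟩ := ha i
    obtain ⟨t, ht⟩ := hb i
    exact ⟨s + t, by simp [hs, ht]⟩
  zero_mem' := fun _ => ⟨0, by simp⟩
  neg_mem' := fun {a} ha i => by
    obtain ⟨s, hs⟩ := ha i
    exact ⟨-s, by simp [hs]⟩

/-- The cone spanned by a nonempty convex set, as an additive submonoid. -/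
def coneOver {E : Type*} [AddCommGroup E] [Module ℝ E] (P : Set E) (hP : Convex ℝ P)
    (hne : P.Nonempty) : AddSubmonoid E where
  carrier := {y | ∃ c : ℝ, 0 ≤ c ∧ ∃ p ∈ P, y = c • p}
  zero_mem' := ⟨0, le_rfl, hne.some, hne.some_mem, by simp⟩
  add_mem' := by
    rintro _ _ ⟨c, hc, p, hp, rfl⟩ ⟨e, he, q, hq, rfl⟩
    rcases (add_nonneg hc he).eq_or_lt with h | h
    · obtain rfl : c = 0 := by linarith
      obtain rfl : e = 0 := by linarith
      exact ⟨0, le_rfl, p, hp, by simp⟩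
    · refine ⟨c + e, h.le, (c / (c + e)) • p + (e / (c + e)) • q,
        hP hp hq (by positivity) (by positivity) (by field_simp), ?_⟩
      rw [smul_add, smul_smul, smul_smul, mul_div_cancel₀ _ h.ne', mul_div_cancel₀ _ h.ne']

theorem smul_mem_coneOver {E : Type*} [AddCommGroup E] [Module ℝ E] {P : Set E}
    {hP : Convex ℝ P} {hne : P.Nonempty} {y : E} (hy : y ∈ coneOver P hP hne) {c : ℝ}
    (hc : 0 ≤ c) : c • y ∈ coneOver P hP hne := by
  obtain ⟨e, he, p, hp, rfl⟩ := hy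
  exact ⟨c * e, mul_nonneg hc he, p, hp, smul_smul c e p⟩

theorem smul_mem_coneOver_of_mem {E : Type*} [AddCommGroup E] [Module ℝ E] {P : Set E}
    {hP : Convex ℝ P} {hne : P.Nonempty} {p : E} (hp : p ∈ P) {c : ℝ} (hc : 0 ≤ c) :
    c • p ∈ coneOver P hP hne := ⟨c, hc, p, hp, rfl⟩

/-- **Carathéodory's theorem for cones**: a nonnegative combination can be rewritten as a
nonnegative combination of a linearly independent subfamily. -/
theorem exists_linearIndepOn_nonneg_sum_eq {ι F : Type*} [AddCommGroup F] [Module ℝ F]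
    (f : ι → F) (s : Finset ι) (c : ι → ℝ) (hc : ∀ i ∈ s, 0 ≤ c i) :
    ∃ t ⊆ s, ∃ e : ι → ℝ, (∀ i ∈ t, 0 ≤ e i) ∧ LinearIndepOn ℝ f (t : Set ι) ∧
      ∑ i ∈ t, e i • f i = ∑ i ∈ s, c i • f i := by
  classical
  induction s using Finset.strongInduction generalizing c with
  | H s ih =>
    by_cases hli : LinearIndepOn ℝ f (s : Set ι)
    · exact ⟨s, subset_rfl, c, hc, hli, rfl⟩
    obtain ⟨g, hg, j, hjs, hj⟩ : ∃ g : ι → ℝ, ∑ i ∈ s, g i • f i = 0 ∧ ∃ j ∈ s, 0 < g j := by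
      rw [linearIndepOn_finset_iff] at hli
      push Not at hli
      obtain ⟨g, hg, j, hjs, hj⟩ := hli
      rcases hj.lt_or_gt with h | h
      · exact ⟨-g, by simp [hg], j, hjs, by simpa using h⟩
      · exact ⟨g, hg, j, hjs, h⟩
    obtain ⟨k, hk, hmin⟩ := Finset.exists_min_image (s.filter fun i => 0 < g i)
      (fun i => c i / g i) ⟨j, by simp [hjs, hj]⟩
    obtain ⟨hks, hgk⟩ := Finset.mem_filter.mp hk
    set r := c k / g k with hr
    have hr0 : 0 ≤ r := div_nonneg (hc k hks) hgk.le
    have hnonneg : ∀ i ∈ s, 0 ≤ c i - r * g i := by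
      intro i hi
      rcases le_or_gt (g i) 0 with h | h
      · nlinarith [hc i hi, mul_nonneg hr0 (neg_nonneg.mpr h)]
      · have := hmin i (by simp [hi, h])
        rw [le_div_iff₀ h] at this
        linarith
    obtain ⟨t, hts, e, he, hli', hsum⟩ := ih (s.erase k) (Finset.erase_ssubset hks)
      (fun i => c i - r * g i) fun i hi => hnonneg i (Finset.mem_of_mem_erase hi)
    refine ⟨t, hts.trans (Finset.erase_subset _ _), e, he, hli', ?_⟩
    rw [hsum, Finset.sum_erase]
    · simp [sub_smul, Finset.sum_sub_distrib, mul_smul, ← Finset.smul_sum, hg]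
    · simp [hr, div_mul_cancel₀ _ hgk.ne']

/-- Homotheties map relative interiors into relative interiors, provided that the affine spans
correspond. -/
theorem smul_add_mem_intrinsicInterior {E : Type*} [NormedAddCommGroup E] [NormedSpace ℝ E]
    {s t : Set E} {x u : E} {δ : ℝ} (hδ : δ ≠ 0) (hx : x ∈ intrinsicInterior ℝ s)
    (hst : ∀ z ∈ s, δ • z + u ∈ t)
    (hspan : ∀ w ∈ affineSpan ℝ t, δ⁻¹ • (w - u) ∈ affineSpan ℝ s) :
    δ • x + u ∈ intrinsicInterior ℝ t := by
  let φ : affineSpan ℝ t → affineSpan ℝ s := fun w => ⟨δ⁻¹ • ((w : E) - u), hspan w w.2⟩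
  have hφ : Continuous φ := by fun_prop
  refine mem_intrinsicInterior.mpr
    ⟨⟨δ • x + u, subset_affineSpan ℝ t (hst x (intrinsicInterior_subset hx))⟩, ?_, rfl⟩
  obtain ⟨x', hx', rfl⟩ := mem_intrinsicInterior.mp hx
  refine mem_interior.mpr ⟨φ ⁻¹' interior ((↑) ⁻¹' s), ?_, isOpen_interior.preimage hφ, ?_⟩
  · intro w hw
    have := hst _ (interior_subset (s := ((↑) ⁻¹' s : Set (affineSpan ℝ s))) hw)
    simpa [φ, smul_smul, hδ] using this
  · simpa [φ, smul_smul, hδ] using hx'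

/-- If `P` has height one, then the affine span of `c • P` has height `c`. -/
theorem last_eq_of_mem_affineSpan_smul {n : ℕ} {P : Set (Fin (n + 1) → ℝ)}
    (hheight : ∀ p ∈ P, p (Fin.last n) = 1) {c : ℝ} {w : Fin (n + 1) → ℝ}
    (hw : w ∈ affineSpan ℝ (c • P)) : w (Fin.last n) = c := by
  refine affineSpan_induction (p := fun w => w (Fin.last n) = c) hw ?_ ?_
  · rintro _ ⟨p, hp, rfl⟩
    simp [hheight p hp]
  · intro r u v w hu hv hw
    simp [hu, hv, hw]

theorem mem_affineSpan_smul_of_last_eq {n : ℕ} {ι : Type*} [Fintype ι]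
    {P : Set (Fin (n + 1) → ℝ)} (hheight : ∀ p ∈ P, p (Fin.last n) = 1)
    {v : ι → Fin (n + 1) → ℝ} (hv : ∀ i, v i ∈ P) {a : ι → ℝ} {c : ℝ} (hc : c ≠ 0)
    (hsum : (∑ i, a i • v i) (Fin.last n) = c) : ∑ i, a i • v i ∈ affineSpan ℝ (c • P) := by
  have ha : ∑ i, a i / c = 1 := by
    rw [← Finset.sum_div, div_eq_one_iff_eq hc, ← hsum]
    simp [Finset.sum_apply, hheight _ (hv _)]
  have hmem := affineCombination_mem_affineSpan (k := ℝ) ha (fun i => c • v i)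
  rw [Finset.univ.affineCombination_eq_linear_combination _ _ ha] at hmem
  have hsub : Set.range (fun i => c • v i) ⊆ c • P := by
    rintro _ ⟨i, rfl⟩
    exact Set.smul_mem_smul_set (hv i)
  convert affineSpan_mono ℝ hsub hmem using 2 with i
  rw [smul_smul, div_mul_cancel₀ _ hc]

/-- Adding a point of the cone to a positive multiple of a relatively interior point of a dilate
of `P` yields a relatively interior point of another dilate. -/
theorem smul_add_mem_intrinsicInterior_of_mem_coneOver {n : ℕ} {ι : Type*} [Fintype ι]
    {P : Set (Fin (n + 1) → ℝ)} (hP : Convex ℝ P) (hne : P.Nonempty)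
    (hheight : ∀ p ∈ P, p (Fin.last n) = 1)
    {v : ι → Fin (n + 1) → ℝ} (hv : ∀ i, v i ∈ P)
    (hspan : ∀ y : Fin (n + 1) → ℝ, ∃ a : ι → ℝ, y = ∑ i, a i • v i)
    {k l : ℝ} (hk : 0 < k) {x u : Fin (n + 1) → ℝ} (hx : x ∈ intrinsicInterior ℝ (k • P))
    (hu : u ∈ coneOver P hP hne) {δ : ℝ} (hδ : 0 < δ)
    (hl : (δ • x + u) (Fin.last n) = l) : δ • x + u ∈ intrinsicInterior ℝ (l • P) := by
  obtain ⟨c, hc, p, hp, rfl⟩ := hu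
  have hxk : x (Fin.last n) = k := last_eq_of_mem_affineSpan_smul hheight
    (subset_affineSpan ℝ _ (intrinsicInterior_subset hx))
  have hl' : δ * k + c = l := by simpa [hxk, hheight p hp] using hl
  apply smul_add_mem_intrinsicInterior hδ.ne' hx
  · rintro _ ⟨q, hq, rfl⟩
    rw [← hl', hP.add_smul (by positivity) hc]
    refine Set.add_mem_add ?_ (Set.smul_mem_smul_set hp)
    rw [mul_smul]
    exact Set.smul_mem_smul_set (Set.smul_mem_smul_set hq)
  · intro w hw
    have hwl := last_eq_of_mem_affineSpan_smul hheight hw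
    obtain ⟨a, ha⟩ := hspan (δ⁻¹ • (w - c • p))
    rw [ha]
    apply mem_affineSpan_smul_of_last_eq hheight hv hk.ne'
    rw [← ha]
    simp only [Pi.smul_apply, Pi.sub_apply, smul_eq_mul, hheight p hp, hwl]
    field_simp
    linarith

theorem eventually_mul_le_of_pos (c : ℝ) {d : ℝ} (hd : 0 < d) :
    ∀ᶠ ε in 𝓝[>] (0 : ℝ), ε * c ≤ d := by
  have h : Tendsto (fun ε : ℝ => ε * c) (𝓝[>] 0) (𝓝 0) := by
    have : Tendsto (fun ε : ℝ => ε * c) (𝓝 0) (𝓝 (0 * c)) :=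
      (continuous_id.mul continuous_const).tendsto 0
    rw [zero_mul] at this
    exact this.mono_left nhdsWithin_le_nhds
  exact (h.eventually (gt_mem_nhds hd)).mono fun _ => le_of_lt

/-- Suppose that `m • P` has no lattice points in its relative interior while `∑ i, a i • v i` is
one for `(m + 1) • P`. If subtracting a small multiple of `∑ i, w i • v i` from the sum of the
lattice points in `G` does not leave the cone, then at most `#F + #G` of the coordinates `w i` with
`1 ≤ a i` are positive, where `F` contains the indices with `a i = 0` and `w i < 0`. -/
theorem card_le_card_add_card_of_no_interior_lattice_point {n m : ℕ} {ι : Type*} [Fintype ι]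
    [Nonempty ι] {P : Set (Fin (n + 1) → ℝ)} (hP : Convex ℝ P) (hne : P.Nonempty)
    (hheight : ∀ p ∈ P, p (Fin.last n) = 1)
    (hNoInt : ∀ q, IsLatticePoint q → q ∉ intrinsicInterior ℝ ((m : ℝ) • P))
    {v : ι → Fin (n + 1) → ℝ} (hv : ∀ i, v i ∈ P) (hvint : ∀ i, IsLatticePoint (v i))
    (hspan : ∀ y : Fin (n + 1) → ℝ, ∃ a : ι → ℝ, y = ∑ i, a i • v i)
    {a w : ι → ℝ} (ha : ∀ i, 0 ≤ a i) (hxint : IsLatticePoint (∑ i, a i • v i))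
    (hx : ∑ i, a i • v i ∈ intrinsicInterior ℝ (((m + 1 : ℕ) : ℝ) • P))
    {D F : Finset ι} (hD : ∀ i ∈ D, 1 ≤ a i ∧ 0 < w i)
    (hF : ∀ i, a i = 0 → w i < 0 → i ∈ F) {G : Finset (Fin (n + 1) → ℝ)}
    (hG : ∀ g ∈ G, g ∈ P ∧ IsLatticePoint g)
    (hGw : ∀ᶠ ε in 𝓝[>] (0 : ℝ), ∑ g ∈ G, g - ε • ∑ i, w i • v i ∈ coneOver P hP hne) :
    D.card ≤ F.card + G.card := by
  classical
  by_contra! hlt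
  obtain ⟨k, hk⟩ := Nat.exists_eq_add_of_le (Nat.succ_le_of_lt hlt)
  obtain ⟨ε, hε, hεG, hεw⟩ : ∃ ε : ℝ, 0 < ε ∧
      ∑ g ∈ G, g - ε • ∑ i, w i • v i ∈ coneOver P hP hne ∧
      ∀ i, ε * -w i ≤ 1 ∧ (0 < a i → ε * -w i ≤ a i / 2) := by
    have hall : ∀ᶠ ε in 𝓝[>] (0 : ℝ), ∀ i, ε * -w i ≤ 1 ∧ (0 < a i → ε * -w i ≤ a i / 2) := by
      refine eventually_all.mpr fun i => (eventually_mul_le_of_pos _ one_pos).and ?_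
      by_cases h : 0 < a i
      · exact (eventually_mul_le_of_pos _ (half_pos h)).mono fun _ h' _ => h'
      · exact Eventually.of_forall fun _ h' => absurd h' h
    obtain ⟨ε, hε, h⟩ := (eventually_mem_nhdsWithin.and (hGw.and hall)).exists
    exact ⟨ε, hε, h⟩
  obtain ⟨δ, hδ, hδ2, hδw⟩ : ∃ δ : ℝ, 0 < δ ∧ δ * 1 ≤ 1 / 2 ∧
      ∀ i, 0 < w i → δ * a i ≤ ε * w i := by
    have hall : ∀ᶠ δ in 𝓝[>] (0 : ℝ), ∀ i, 0 < w i → δ * a i ≤ ε * w i := by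
      refine eventually_all.mpr fun i => ?_
      by_cases h : 0 < w i
      · exact (eventually_mul_le_of_pos _ (mul_pos hε h)).mono fun _ h' _ => h'
      · exact Eventually.of_forall fun _ h' => absurd h' h
    obtain ⟨δ, hδ, h⟩ := (eventually_mem_nhdsWithin.and
      ((eventually_mul_le_of_pos 1 one_half_pos).and hall)).exists
    exact ⟨δ, hδ, h⟩
  obtain ⟨o⟩ := ‹Nonempty ι›
  let r : ι → ℝ := fun i =>
    a i - (if i ∈ D then 1 else 0) + (if i ∈ F then 1 else 0) + ε * w i - δ * a i
  have hr : ∀ i, 0 ≤ r i := by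
    intro i
    have h1 := hεw i
    have h2 := hδw i
    have hFi : (0 : ℝ) ≤ if i ∈ F then 1 else 0 := by split_ifs <;> norm_num
    simp only [r]
    by_cases hiD : i ∈ D
    · rw [if_pos hiD]
      linarith [hD i hiD, h2 (hD i hiD).2]
    · rw [if_neg hiD]
      rcases (ha i).eq_or_lt with h | h
      · rcases lt_or_ge (w i) 0 with hw | hw
        · rw [if_pos (hF i h.symm hw), ← h]
          linarith
        · rw [← h]
          linarith [mul_nonneg hε.le hw]
      · have := h1.2 h
        nlinarith
  have hq : ∑ i, a i • v i - ∑ i ∈ D, v i + ∑ i ∈ F, v i + ∑ g ∈ G, g + k • v o =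
      δ • ∑ i, a i • v i +
        ((∑ g ∈ G, g - ε • ∑ i, w i • v i) + ∑ i, r i • v i + (k : ℝ) • v o) := by
    simp only [r, sub_smul, add_smul, Finset.sum_add_distrib, Finset.sum_sub_distrib, mul_smul,
      ← Finset.smul_sum, ite_smul, one_smul, zero_smul, Finset.sum_ite_mem, Finset.univ_inter,
      Nat.cast_smul_eq_nsmul]
    abel
  refine hNoInt _ ?_ (hq ▸ smul_add_mem_intrinsicInterior_of_mem_coneOver hP hne hheight hv hspan
    (by positivity) hx (add_mem (add_mem hεG (sum_mem fun i _ =>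
      smul_mem_coneOver_of_mem (hv i) (hr i))) (smul_mem_coneOver_of_mem (hv o) k.cast_nonneg)) hδ
    ?_)
  · have hL : ∀ i, v i ∈ latticePoints (n + 1) := hvint
    exact add_mem (add_mem (add_mem (sub_mem (show _ ∈ latticePoints (n + 1) from hxint)
      (sum_mem fun i _ => hL i)) (sum_mem fun i _ => hL i)) (sum_mem fun g hg => (hG g hg).2))
      (nsmul_mem (hL o) k)
  · have hxk := last_eq_of_mem_affineSpan_smul hheight
      (subset_affineSpan ℝ _ (intrinsicInterior_subset hx))
    have hGc : ∑ g ∈ G, g (Fin.last n) = G.card := by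
      rw [Finset.sum_congr rfl fun g hg => hheight g (hG g hg).1]
      simp
    have hkc : (D.card : ℝ) = F.card + G.card + 1 + k := by exact_mod_cast hk
    rw [← hq]
    simp only [Pi.add_apply, Pi.sub_apply, hxk]
    simp only [Finset.sum_apply, hheight _ (hv _), hGc, Pi.smul_apply]
    simp
    linarith


/- **Setup** (Section 2): `P ⊆ ℝ^{n+1}` is an `n`-dimensional lattice polytope contained
in the hyperplane `x_{n+1} = 1`, of degree `d`: `(n−d)P` has no lattice points in its
relative interior, and `x` is a lattice point in the relative interior of `(n−d+1)P`.
`S ⊆ P` is an `n`-dimensional lattice simplex with vertices `v_0, …, v_n` whose spanned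
cone contains `x`, and `b y` gives the unique coefficients of `y` in the basis
`v_0, …, v_n`, i.e. `y = ∑ i, b y i • v i`. -/
/-- (Lemma 2.6 / `second bound V+`.) For any point `y` in the cone `σ`
spanned by `P`, there is a point `y' ∈ σ` such that `V⁻(y') ⊇ V⁻(y)` and
`|V⁺(y')| ≤ |Z|`. -/
theorem statement8 (n d : ℕ) (P : Set (Fin (n + 1) → ℝ))
    (v : Fin (n + 1) → Fin (n + 1) → ℝ) (b : (Fin (n + 1) → ℝ) → Fin (n + 1) → ℝ)
    (x : Fin (n + 1) → ℝ)
    (hP : IsLatticePolytope P)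
    (hPdim : Module.finrank ℝ (vectorSpan ℝ P) = n)
    (hheight : ∀ p ∈ P, p (Fin.last n) = 1)
    (hdn : d ≤ n)
    (hNoInt : ∀ z : Fin (n + 1) → ℤ,
      (fun i => (z i : ℝ)) ∉ intrinsicInterior ℝ (((n - d : ℕ) : ℝ) • P))
    (hxint : IsLatticePoint x)
    (hxmem : x ∈ intrinsicInterior ℝ (((n - d + 1 : ℕ) : ℝ) • P))
    (hvint : ∀ i, IsLatticePoint (v i))
    (hvmem : ∀ i, v i ∈ P)
    (hvaff : AffineIndependent ℝ v)
    (hb : ∀ y : Fin (n + 1) → ℝ, y = ∑ i, b y i • v i)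
    (hxcone : ∀ i, 0 ≤ b x i)
    (y : Fin (n + 1) → ℝ)
    (hy : ∃ c : ℝ, 0 ≤ c ∧ ∃ p ∈ P, y = c • p) :
    ∃ y' : Fin (n + 1) → ℝ, (∃ c : ℝ, 0 ≤ c ∧ ∃ p ∈ P, y' = c • p) ∧
      {j : Fin (n + 1) | (∃ m : ℤ, 0 < m ∧ b x j = (m : ℝ)) ∧ b y j < 0} ⊆
        {j : Fin (n + 1) | (∃ m : ℤ, 0 < m ∧ b x j = (m : ℝ)) ∧ b y' j < 0} ∧
      Set.ncard {j : Fin (n + 1) | (∃ m : ℤ, 0 < m ∧ b x j = (m : ℝ)) ∧ 0 < b y' j} ≤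
        Set.ncard {i : Fin (n + 1) | b x i = 0} := by
  classical
  obtain ⟨Vs, hVne, hVint, rfl⟩ := hP
  set P : Set (Fin (n + 1) → ℝ) := convexHull ℝ (Vs : Set (Fin (n + 1) → ℝ)) with hPdef
  have hPc : Convex ℝ P := convex_convexHull ℝ _
  have hVP : ∀ g ∈ Vs, g ∈ P := fun g hg => subset_convexHull ℝ _ hg
  have hPne : P.Nonempty := hVne.imp hVP
  have hspan : ∀ z : Fin (n + 1) → ℝ, ∃ a : Fin (n + 1) → ℝ, z = ∑ i, a i • v i :=
    fun z => ⟨b z, hb z⟩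
  have hvli : LinearIndependent ℝ v := by
    refine linearIndependent_of_top_le_span_of_card_eq_finrank (fun z _ => ?_) (by simp)
    rw [hb z]
    exact sum_mem fun i _ => Submodule.smul_mem _ _ (Submodule.subset_span ⟨i, rfl⟩)
  have hbsum : ∀ (t : Finset (Fin (n + 1) → ℝ)) (c : (Fin (n + 1) → ℝ) → ℝ) (j),
      b (∑ g ∈ t, c g • g) j = ∑ g ∈ t, c g * b g j := by
    intro t c j
    refine congrFun (hvli.fintypeLinearCombination_injective
      (a₁ := b (∑ g ∈ t, c g • g)) (a₂ := fun j => ∑ g ∈ t, c g * b g j) ?_) j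
    simp only [Fintype.linearCombination_apply]
    rw [← hb, Finset.sum_congr rfl fun g _ => congrArg (c g • ·) (hb g)]
    simp only [Finset.smul_sum, Finset.sum_smul, mul_smul]
    exact Finset.sum_comm
  have hNoInt' : ∀ q, IsLatticePoint q → q ∉ intrinsicInterior ℝ (((n - d : ℕ) : ℝ) • P) := by
    intro q hq
    choose z hz using hq
    rw [funext hz]
    exact hNoInt z
  obtain ⟨c, hc, hyc⟩ : ∃ c : (Fin (n + 1) → ℝ) → ℝ, (∀ g ∈ Vs, 0 ≤ c g) ∧
      y = ∑ g ∈ Vs, c g • g := by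
    obtain ⟨r, hr, p, hp, rfl⟩ := hy
    obtain ⟨c, hc, -, rfl⟩ := Finset.mem_convexHull'.mp hp
    exact ⟨fun g => r * c g, fun g hg => mul_nonneg hr (hc g hg),
      by simp [Finset.smul_sum, mul_smul]⟩
  let A : Finset (Fin (n + 1)) :=
    Finset.univ.filter fun j => (∃ m : ℤ, 0 < m ∧ b x j = (m : ℝ)) ∧ b y j < 0
  obtain ⟨t, htV, e, he, hli, hsum⟩ :=
    exists_linearIndepOn_nonneg_sum_eq (fun g (j : A) => b g j) Vs c hc
  have htA : t.card ≤ A.card := by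
    have := LinearIndependent.fintype_card_le_finrank hli
    simpa using this
  let y' : Fin (n + 1) → ℝ := ∑ g ∈ t, e g • g
  have hy'b : ∀ j ∈ A, b y' j = b y j := by
    intro j hj
    have := congrFun hsum ⟨j, hj⟩
    rw [hyc, hbsum, hbsum]
    simpa [Finset.sum_apply] using this
  have hy'cone : y' ∈ coneOver P hPc hPne :=
    sum_mem fun g hg => smul_mem_coneOver_of_mem (hVP g (htV hg)) (he g hg)
  have hxint' := hb x ▸ hxint
  have hxmem' := hb x ▸ hxmem
  have hone : ∀ j, (∃ m : ℤ, 0 < m ∧ b x j = (m : ℝ)) → 1 ≤ b x j := by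
    rintro j ⟨m, hm, h⟩
    rw [h]
    exact_mod_cast hm
  let Z : Finset (Fin (n + 1)) := Finset.univ.filter fun i => b x i = 0
  let Vneg : Finset (Fin (n + 1)) :=
    Finset.univ.filter fun j => (∃ m : ℤ, 0 < m ∧ b x j = (m : ℝ)) ∧ b y' j < 0
  let Vpos : Finset (Fin (n + 1)) :=
    Finset.univ.filter fun j => (∃ m : ℤ, 0 < m ∧ b x j = (m : ℝ)) ∧ 0 < b y' j
  have hAneg : A ⊆ Vneg := by
    intro j hj
    have hjA := (Finset.mem_filter.mp hj).2
    exact Finset.mem_filter.mpr ⟨Finset.mem_univ j, hjA.1, (hy'b j hj).symm ▸ hjA.2⟩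
  have hneg : Vneg.card ≤ (Z.filter fun i => 0 < b y' i).card := by
    have := card_le_card_add_card_of_no_interior_lattice_point hPc hPne hheight hNoInt' hvmem
      hvint hspan hxcone hxint' hxmem' (w := fun i => -b y' i) (D := Vneg)
      (F := Z.filter fun i => 0 < b y' i) (G := ∅)
      (fun i hi => by
        obtain ⟨-, h, h'⟩ := Finset.mem_filter.mp hi
        exact ⟨hone i h, neg_pos.mpr h'⟩)
      (fun i h h' => by simp [Z, h, neg_neg_iff_pos.mp h']) (by simp)
      (by
        filter_upwards [self_mem_nhdsWithin] with ε hε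
        simpa [← hb y'] using smul_mem_coneOver hy'cone (le_of_lt hε))
    simpa using this
  have hpos : Vpos.card ≤ (Z.filter fun i => ¬ 0 < b y' i).card + t.card := by
    refine card_le_card_add_card_of_no_interior_lattice_point hPc hPne hheight hNoInt' hvmem
      hvint hspan hxcone hxint' hxmem' (w := b y')
      (fun i hi => by
        obtain ⟨-, h, h'⟩ := Finset.mem_filter.mp hi
        exact ⟨hone i h, h'⟩)
      (fun i h h' => by simp [Z, h, h'.le])
      (fun g hg => ⟨hVP g (htV hg), hVint g (htV hg)⟩) ?_
    have hall : ∀ᶠ ε in 𝓝[>] (0 : ℝ), ∀ g ∈ t, ε * e g ≤ 1 :=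
      (eventually_all_finset t).mpr fun g _ => eventually_mul_le_of_pos _ one_pos
    filter_upwards [hall] with ε hε
    rw [← hb y', Finset.smul_sum, ← Finset.sum_sub_distrib]
    refine sum_mem fun g hg => ?_
    have := smul_mem_coneOver_of_mem (hP := hPc) (hne := hPne) (hVP g (htV hg))
      (sub_nonneg.mpr (hε g hg))
    rwa [sub_smul, one_smul, mul_smul] at this
  refine ⟨y', hy'cone, fun j hj => ?_, ?_⟩
  · have := hAneg (Finset.mem_filter.mpr ⟨Finset.mem_univ j, hj⟩)
    exact (Finset.mem_filter.mp this).2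
  · have hZ := Finset.card_filter_add_card_filter_not (s := Z) fun i => 0 < b y' i
    have hAcard := Finset.card_le_card hAneg
    have h : Vpos.card ≤ Z.card := by omega
    simpa [Vpos, Z, ← Set.ncard_coe_finset] using h

end
end
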